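/- arXiv:1308.2358 — 4 statements merged into one kernel-verified Lean document; each statement's English description precedes it below -/
import Mathlib

section
/- For every integer b ≥ 1 there exists N such that for all n ≥ N the sequence c_{n,b}(0), c_{n,b}(1), ..., c_{n,b}(bn − b(b−1)/2) is unimodal; that is, there exists an index k with c_{n,b}(0) ≤ c_{n,b}(1) ≤ ... ≤ c_{n,b}(k) ≥ c_{n,b}(k+1) ≥ ... ≥ c_{n,b}(bn − b(b−1)/2). -/
/-- `c n b ℓ` is the number of partitions of `ℓ` into at most `b` distinct parts,
each part of size at most `n`, encoded as finsets of `{1, …, n}` of cardinality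
at most `b` with sum `ℓ`. -/
def truncStaircaseCount (n b ℓ : ℕ) : ℕ :=
  (((Finset.Icc 1 n).powerset).filter (fun s => s.card ≤ b ∧ s.sum id = ℓ)).card

namespace TruncatedStaircase

open LaurentPolynomial Finset

noncomputable section

/-- The geometric sum `1 + q ^ j + ⋯ + q ^ (j * (N - 1))`. -/
def geom (N j : ℕ) : ℤ[T;T⁻¹] := ∑ i ∈ range N, T ((i * j : ℕ) : ℤ)

/-- The generating function, by sum of elements, of the `k`-subsets of `{0, …, N - 1}`. -/
def subsetGen (N k : ℕ) : ℤ[T;T⁻¹] :=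
  ∑ s ∈ powersetCard k (range N), T ((∑ i ∈ s, i : ℕ) : ℤ)

lemma T_natCast_sum (s : Finset ℕ) :
    (T ((∑ i ∈ s, i : ℕ) : ℤ) : ℤ[T;T⁻¹]) = ∏ i ∈ s, T (i : ℤ) := by
  induction s using Finset.induction_on with
  | empty => simp
  | insert a s ha ih => rw [sum_insert ha, prod_insert ha, ← ih, Nat.cast_add, T_add]

lemma coeff_T_mul (P : ℤ[T;T⁻¹]) (n z : ℤ) : (T n * P).coeff z = P.coeff (z - n) := by
  rw [LaurentPolynomial.T, AddMonoidAlgebra.coeff_single_mul_apply]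
  simp [neg_add_eq_sub]

lemma coeff_one_sub_T_mul (P : ℤ[T;T⁻¹]) (n z : ℤ) :
    ((1 - T n) * P).coeff z = P.coeff z - P.coeff (z - n) := by
  rw [sub_mul, one_mul, AddMonoidAlgebra.coeff_sub, Finsupp.sub_apply, coeff_T_mul]

lemma coeff_intCast_mul (P : ℤ[T;T⁻¹]) (n z : ℤ) :
    ((n : ℤ[T;T⁻¹]) * P).coeff z = n * P.coeff z := by
  rw [← zsmul_eq_mul, AddMonoidAlgebra.coeff_smul, Finsupp.smul_apply, smul_eq_mul]

lemma coeff_natCast_mul (P : ℤ[T;T⁻¹]) (n : ℕ) (z : ℤ) :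
    ((n : ℤ[T;T⁻¹]) * P).coeff z = n * P.coeff z := by
  simpa using coeff_intCast_mul P n z

lemma coeff_finset_sum {ι : Type*} (s : Finset ι) (P : ι → ℤ[T;T⁻¹]) (z : ℤ) :
    (∑ i ∈ s, P i).coeff z = ∑ i ∈ s, (P i).coeff z := by
  simp

lemma coeff_geom_mul (N j : ℕ) (P : ℤ[T;T⁻¹]) (z : ℤ) :
    (geom N j * P).coeff z = ∑ i ∈ range N, P.coeff (z - (i * j : ℕ)) := by
  simp only [geom, sum_mul, coeff_finset_sum, coeff_T_mul]

lemma coeff_geom (N : ℕ) {j : ℕ} (hj : 0 < j) (z : ℤ) :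
    (geom N j).coeff z = if 0 ≤ z ∧ z < j * N ∧ (j : ℤ) ∣ z then 1 else 0 := by
  simp only [geom, coeff_finset_sum, T_apply]
  have hj' : (0 : ℤ) < j := by exact_mod_cast hj
  split_ifs with h
  · obtain ⟨h0, h1, w, rfl⟩ := h
    have hw : 0 ≤ w := by nlinarith
    lift w to ℕ using hw
    have hwN : w < N := by
      have : (w : ℤ) < N := lt_of_mul_lt_mul_left h1 hj'.le
      exact_mod_cast this
    rw [sum_eq_single w]
    · rw [if_pos (by push_cast; ring)]
    · intro i _ hi
      rw [if_neg]
      intro h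
      apply hi
      have : (j : ℤ) * i = j * w := by rw [← h]; push_cast; ring
      exact_mod_cast mul_left_cancel₀ hj'.ne' this
    · simp [hwN]
  · refine sum_eq_zero fun i hi ↦ if_neg ?_
    rintro rfl
    refine h ⟨by positivity, ?_, ⟨i, by push_cast; ring⟩⟩
    have : (i : ℤ) < N := by exact_mod_cast mem_range.1 hi
    push_cast
    nlinarith

lemma one_sub_T_mul_geom (N j : ℕ) : (1 - T (j : ℤ)) * geom N j = 1 - T ((N * j : ℕ) : ℤ) := by
  induction N with
  | zero => simp [geom]
  | succ N ih =>
    rw [geom, sum_range_succ, ← geom, mul_add, ih, add_mul, Nat.cast_add, T_add]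
    simp only [one_mul]
    ring

lemma subsetGen_eq_aeval (N k : ℕ) :
    subsetGen N k = MvPolynomial.aeval (fun i : Fin N ↦ (T ((i : ℕ) : ℤ) : ℤ[T;T⁻¹]))
      (MvPolynomial.esymm (Fin N) ℤ k) := by
  rw [MvPolynomial.aeval_esymm_eq_multiset_esymm]
  have h : (univ : Finset (Fin N)).val.map (fun i : Fin N ↦ (T ((i : ℕ) : ℤ) : ℤ[T;T⁻¹])) =
      (range N).val.map fun i : ℕ ↦ (T (i : ℤ) : ℤ[T;T⁻¹]) := by
    rw [← Nat.Iio_eq_range, ← Fin.map_valEmbedding_univ, Finset.map_val, Multiset.map_map]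
    rfl
  rw [h, Finset.esymm_map_val]
  simp only [subsetGen, T_natCast_sum]

lemma newton (N k : ℕ) :
    (k : ℤ[T;T⁻¹]) * subsetGen N k =
      ∑ j ∈ Icc 1 k, (-1) ^ (j + 1) * (subsetGen N (k - j) * geom N j) := by
  have h := congrArg (MvPolynomial.aeval fun i : Fin N ↦ (T ((i : ℕ) : ℤ) : ℤ[T;T⁻¹]))
    (MvPolynomial.mul_esymm_eq_sum (Fin N) ℤ k)
  have hp (j : ℕ) : MvPolynomial.aeval (fun i : Fin N ↦ (T ((i : ℕ) : ℤ) : ℤ[T;T⁻¹]))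
      (MvPolynomial.psum (Fin N) ℤ j) = geom N j := by
    simp only [MvPolynomial.psum, map_sum, map_pow, MvPolynomial.aeval_X, T_pow, geom]
    rw [Fin.sum_univ_eq_sum_range (fun i ↦ (T ((j : ℤ) * (i : ℤ)) : ℤ[T;T⁻¹]))]
    simp [mul_comm]
  simp only [map_mul, map_natCast, map_pow, map_neg, map_one, map_sum, ← subsetGen_eq_aeval,
    hp] at h
  rw [h, mul_sum]
  symm
  refine sum_bij' (fun j _ ↦ (k - j, j)) (fun a _ ↦ a.2) ?_ ?_ ?_ ?_ ?_
  · intro j hj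
    simp only [mem_Icc, mem_filter, HasAntidiagonal.mem_antidiagonal] at hj ⊢
    omega
  · rintro ⟨a, b⟩ hj
    simp only [mem_Icc, mem_filter, HasAntidiagonal.mem_antidiagonal] at hj ⊢
    omega
  · simp
  · rintro ⟨a, b⟩ hj
    simp only [mem_filter, HasAntidiagonal.mem_antidiagonal] at hj
    simp only [Prod.mk.injEq, and_true]
    omega
  · intro j hj
    obtain ⟨hj1, hjk⟩ := mem_Icc.1 hj
    obtain ⟨i, rfl⟩ := Nat.exists_eq_add_of_le' hjk
    have : ((-1 : ℤ[T;T⁻¹]) ^ i * (-1) ^ i) = 1 := by rw [← mul_pow]; simp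
    simp only [Nat.add_sub_cancel]
    linear_combination (-(-1 : ℤ[T;T⁻¹]) ^ (j + 1) * subsetGen N i * geom N j) * this

lemma subsetGen_zero (N : ℕ) : subsetGen N 0 = 1 := by
  simp [subsetGen]

lemma subsetGen_one (N : ℕ) : subsetGen N 1 = geom N 1 := by
  simpa [subsetGen_zero] using newton N 1

lemma two_mul_subsetGen_two (N : ℕ) :
    2 * subsetGen N 2 = geom N 1 ^ 2 - geom N 2 := by
  have h := newton N 2
  simp only [sum_Icc_succ_top (show 1 ≤ 1 + 1 by norm_num), Icc_self, sum_singleton, Nat.reduceAdd,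
    Nat.reduceSub, subsetGen_zero, subsetGen_one] at h
  push_cast at h
  linear_combination h

lemma six_mul_subsetGen_three (N : ℕ) :
    6 * subsetGen N 3 = geom N 1 ^ 3 - 3 * (geom N 1 * geom N 2) + 2 * geom N 3 := by
  have h := newton N 3
  rw [sum_Icc_succ_top (by norm_num), sum_Icc_succ_top (by norm_num)] at h
  simp only [Icc_self, sum_singleton, Nat.reduceAdd, Nat.reduceSub, subsetGen_zero,
    subsetGen_one] at h
  push_cast at h
  linear_combination 2 * h + geom N 1 * two_mul_subsetGen_two N

lemma subsetGen_four (N : ℕ) :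
    24 * subsetGen N 4 = geom N 1 ^ 4 - 6 * (geom N 1 * (geom N 1 * geom N 2))
      + 3 * (geom N 2 * geom N 2) + 8 * (geom N 1 * geom N 3) - 6 * geom N 4 := by
  have h := newton N 4
  rw [sum_Icc_succ_top (by norm_num), sum_Icc_succ_top (by norm_num),
    sum_Icc_succ_top (by norm_num)] at h
  simp only [Icc_self, sum_singleton, Nat.reduceAdd, Nat.reduceSub, subsetGen_zero,
    subsetGen_one] at h
  push_cast at h
  linear_combination 6 * h + geom N 1 * six_mul_subsetGen_three N
    - 3 * geom N 2 * two_mul_subsetGen_two N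

/-- `P` is palindromic with lowest and highest degrees adding up to `d`. -/
def Palindromic (P : ℤ[T;T⁻¹]) (d : ℤ) : Prop := invert P = T (-d) * P

lemma Palindromic.coeff {P : ℤ[T;T⁻¹]} {d : ℤ} (h : Palindromic P d) (z : ℤ) :
    P.coeff (d - z) = P.coeff z := by
  have := congrArg (fun Q : ℤ[T;T⁻¹] ↦ Q.coeff (-z)) h
  simp only [invert_apply, coeff_T_mul] at this
  rw [← neg_neg z, this]
  congr 1
  ring

lemma Palindromic.mul {P Q : ℤ[T;T⁻¹]} {d e : ℤ} (hP : Palindromic P d) (hQ : Palindromic Q e) :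
    Palindromic (P * Q) (d + e) := by
  unfold Palindromic at *
  rw [map_mul, hP, hQ, neg_add, T_add]
  ring

lemma palindromic_geom (N j : ℕ) : Palindromic (geom N j) (j * ((N : ℤ) - 1)) := by
  unfold Palindromic
  simp only [geom, map_sum, invert_T, mul_sum, ← T_add]
  rw [← sum_range_reflect]
  refine sum_congr rfl fun i hi ↦ ?_
  rw [Nat.sub_sub, Nat.cast_mul, Nat.cast_sub (by have := mem_range.1 hi; omega)]
  congr 1
  push_cast
  ring

lemma palindromic_geom_pow (N k : ℕ) : Palindromic (geom N 1 ^ k) (k * ((N : ℤ) - 1)) := by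
  induction k with
  | zero => simp [Palindromic]
  | succ k ih =>
    rw [pow_succ]
    convert ih.mul (palindromic_geom N 1) using 1
    push_cast
    ring

lemma palindromic_subsetGen (N k : ℕ) : Palindromic (subsetGen N k) (k * ((N : ℤ) - 1)) := by
  induction k using Nat.strong_induction_on with
  | _ k ih =>
  rcases Nat.eq_zero_or_pos k with rfl | hk
  · simp [Palindromic, subsetGen_zero]
  have hk' : (k : ℤ[T;T⁻¹]) ≠ 0 := by
    intro h
    have := congrArg (fun Q : ℤ[T;T⁻¹] ↦ Q.coeff 0) h
    have h2 := coeff_natCast_mul (T 0) k 0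
    rw [T_zero, mul_one] at h2
    simp only [h2, ← T_zero, T_apply, if_true] at this
    simp at this
    omega
  unfold Palindromic
  apply mul_left_cancel₀ hk'
  rw [mul_left_comm, newton]
  conv_lhs => rw [← map_natCast (invert (R := ℤ)), ← map_mul, newton]
  rw [map_sum, mul_sum]
  refine sum_congr rfl fun j hj ↦ ?_
  obtain ⟨hj1, hjk⟩ := mem_Icc.1 hj
  have := (ih (k - j) (by omega)).mul (palindromic_geom N j)
  unfold Palindromic at this
  rw [map_mul, this, map_pow, map_neg, map_one, Nat.cast_sub hjk, ← add_mul, sub_add_cancel]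
  ring

/-- The coefficients of `F N` are bounded by a constant multiple of `N ^ a`, for `N ≥ 1`. -/
def CoeffBigO (F : ℕ → ℤ[T;T⁻¹]) (a : ℕ) : Prop :=
  ∃ C : ℕ, ∀ N : ℕ, 1 ≤ N → ∀ z : ℤ, |(F N).coeff z| ≤ C * (N : ℤ) ^ a

namespace CoeffBigO

variable {F G : ℕ → ℤ[T;T⁻¹]} {a b : ℕ}

lemma mono (h : CoeffBigO F a) (hab : a ≤ b) : CoeffBigO F b := by
  obtain ⟨C, hC⟩ := h
  refine ⟨C, fun N hN z ↦ (hC N hN z).trans ?_⟩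
  have : (N : ℤ) ^ a ≤ (N : ℤ) ^ b := pow_le_pow_right₀ (by exact_mod_cast hN) hab
  gcongr

lemma zero : CoeffBigO (fun _ ↦ 0) a := ⟨0, by simp⟩

lemma add (hF : CoeffBigO F a) (hG : CoeffBigO G a) : CoeffBigO (fun N ↦ F N + G N) a := by
  obtain ⟨C, hC⟩ := hF
  obtain ⟨D, hD⟩ := hG
  refine ⟨C + D, fun N hN z ↦ ?_⟩
  rw [AddMonoidAlgebra.coeff_add, Finsupp.add_apply]
  push_cast
  linarith [abs_add_le ((F N).coeff z) ((G N).coeff z), hC N hN z, hD N hN z]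

lemma intCast_mul (hF : CoeffBigO F a) (c : ℤ) : CoeffBigO (fun N ↦ (c : ℤ[T;T⁻¹]) * F N) a := by
  obtain ⟨C, hC⟩ := hF
  refine ⟨c.natAbs * C, fun N hN z ↦ ?_⟩
  rw [coeff_intCast_mul, abs_mul, Nat.cast_mul, mul_assoc, Int.natCast_natAbs]
  exact mul_le_mul_of_nonneg_left (hC N hN z) (abs_nonneg c)

lemma sum {ι : Type*} (s : Finset ι) {F : ι → ℕ → ℤ[T;T⁻¹]} (h : ∀ i ∈ s, CoeffBigO (F i) a) :
    CoeffBigO (fun N ↦ ∑ i ∈ s, F i N) a := by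
  classical
  induction s using Finset.induction_on with
  | empty => simpa using zero
  | insert i s hi ih =>
    simp only [sum_insert hi]
    exact (h i (mem_insert_self i s)).add (ih fun j hj ↦ h j (mem_insert_of_mem hj))

lemma geom_mul (hF : CoeffBigO F a) (j : ℕ) : CoeffBigO (fun N ↦ geom N j * F N) (a + 1) := by
  obtain ⟨C, hC⟩ := hF
  refine ⟨C, fun N hN z ↦ ?_⟩
  rw [coeff_geom_mul]
  refine (abs_sum_le_sum_abs _ _).trans ((sum_le_card_nsmul _ _ _ fun i _ ↦ hC N hN _).trans ?_)
  rw [card_range, nsmul_eq_mul]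
  exact le_of_eq (by ring)

lemma one_sub_T_mul (hF : CoeffBigO F a) (d : ℕ → ℤ) :
    CoeffBigO (fun N ↦ (1 - T (d N)) * F N) a := by
  obtain ⟨C, hC⟩ := hF
  refine ⟨2 * C, fun N hN z ↦ ?_⟩
  rw [coeff_one_sub_T_mul]
  push_cast
  linarith [abs_sub ((F N).coeff z) ((F N).coeff (z - d N)), hC N hN z, hC N hN (z - d N)]

lemma of_natCast_mul {k : ℕ} (hk : 0 < k) (h : CoeffBigO (fun N ↦ (k : ℤ[T;T⁻¹]) * F N) a) :
    CoeffBigO F a := by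
  obtain ⟨C, hC⟩ := h
  refine ⟨C, fun N hN z ↦ le_trans ?_ (hC N hN z)⟩
  rw [coeff_natCast_mul, abs_mul, Nat.abs_cast]
  have : (1 : ℤ) ≤ k := by exact_mod_cast hk
  nlinarith [abs_nonneg ((F N).coeff z)]

end CoeffBigO

lemma coeffBigO_geom {j : ℕ} (hj : 0 < j) : CoeffBigO (fun N ↦ geom N j) 0 := by
  refine ⟨1, fun N _ z ↦ ?_⟩
  rw [coeff_geom N hj]
  split_ifs <;> simp

lemma coeffBigO_mul_subsetGen {A : ℕ → ℤ[T;T⁻¹]} {k a : ℕ} (hk : 0 < k)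
    (h : ∀ j, 1 ≤ j → j ≤ k → CoeffBigO (fun N ↦ A N * (subsetGen N (k - j) * geom N j)) a) :
    CoeffBigO (fun N ↦ A N * subsetGen N k) a := by
  apply CoeffBigO.of_natCast_mul hk
  have : ∀ j ∈ Icc 1 k, CoeffBigO (fun N ↦
      (((-1) ^ (j + 1) : ℤ) : ℤ[T;T⁻¹]) * (A N * (subsetGen N (k - j) * geom N j))) a :=
    fun j hj ↦ (h j (mem_Icc.1 hj).1 (mem_Icc.1 hj).2).intCast_mul _
  convert CoeffBigO.sum _ this using 2 with N
  rw [mul_left_comm, newton, mul_sum]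
  refine sum_congr rfl fun j _ ↦ ?_
  push_cast
  ring

lemma coeffBigO_subsetGen (k : ℕ) : CoeffBigO (fun N ↦ subsetGen N k) (k - 1) := by
  induction k using Nat.strong_induction_on with
  | _ k ih =>
  rcases Nat.eq_zero_or_pos k with rfl | hk
  · refine ⟨1, fun N _ z ↦ ?_⟩
    change |(subsetGen N 0).coeff z| ≤ _
    rw [subsetGen_zero, ← T_zero, T_apply]
    split_ifs <;> simp
  suffices CoeffBigO (fun N ↦ 1 * subsetGen N k) (k - 1) by simpa using this
  refine coeffBigO_mul_subsetGen hk fun j hj hjk ↦ ?_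
  simp only [one_mul]
  rcases hjk.eq_or_lt with rfl | hlt
  · simpa [subsetGen_zero] using (coeffBigO_geom hj).mono (Nat.zero_le _)
  · simp only [mul_comm (subsetGen _ _)]
    exact ((ih (k - j) (by omega)).geom_mul j).mono (by omega)

lemma coeffBigO_diff_subsetGen (k : ℕ) :
    CoeffBigO (fun N ↦ (1 - T 1) * subsetGen N k) (k - 2) := by
  induction k using Nat.strong_induction_on with
  | _ k ih =>
  by_cases hk : k ≤ 1
  · exact ((coeffBigO_subsetGen k).one_sub_T_mul fun _ ↦ 1).mono (by omega)
  refine coeffBigO_mul_subsetGen (by omega) fun j hj hjk ↦ ?_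
  rcases hjk.eq_or_lt with rfl | hlt
  · simpa [subsetGen_zero] using
      ((coeffBigO_geom hj).one_sub_T_mul fun _ ↦ 1).mono (Nat.zero_le _)
  rcases hj.eq_or_lt with rfl | hj1
  · have := ((coeffBigO_subsetGen (k - 1)).one_sub_T_mul fun N ↦ N).mono
      (show k - 1 - 1 ≤ k - 2 by omega)
    convert this using 2 with N
    have h := one_sub_T_mul_geom N 1
    rw [mul_one, Nat.cast_one] at h
    rw [← h]
    ring
  · have := ((ih (k - j) (by omega)).geom_mul j).mono (show _ ≤ k - 2 by omega)
    convert this using 2 with N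
    ring

lemma one_sub_T_mul_geom_one (N : ℕ) : (1 - T 1) * geom N 1 = 1 - T (N : ℤ) := by
  simpa using one_sub_T_mul_geom N 1

lemma coeffBigO_diff_diff_subsetGen (k : ℕ) :
    CoeffBigO (fun N ↦ (1 - T 1) ^ 2 * subsetGen N k) (k - 3) := by
  induction k using Nat.strong_induction_on with
  | _ k ih =>
  by_cases hk : k ≤ 2
  · have := ((coeffBigO_diff_subsetGen k).one_sub_T_mul fun _ ↦ 1).mono
      (show k - 2 ≤ k - 3 by omega)
    simpa only [← mul_assoc, ← sq] using this
  refine coeffBigO_mul_subsetGen (by omega) fun j hj hjk ↦ ?_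
  rcases hjk.eq_or_lt with rfl | hlt
  · have := (((coeffBigO_geom hj).one_sub_T_mul fun _ ↦ 1).one_sub_T_mul fun _ ↦ 1).mono
      (Nat.zero_le (j - 3))
    simpa [subsetGen_zero, ← mul_assoc, ← sq] using this
  rcases hj.eq_or_lt with rfl | hj1
  · have := ((coeffBigO_diff_subsetGen (k - 1)).one_sub_T_mul fun N ↦ N).mono
      (show k - 1 - 2 ≤ k - 3 by omega)
    convert this using 2 with N
    rw [← one_sub_T_mul_geom_one]
    ring
  by_cases hk3 : k = 3
  · obtain rfl : j = 2 := by omega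
    subst hk3
    have := (((coeffBigO_geom two_pos).one_sub_T_mul fun _ ↦ 1).one_sub_T_mul fun N ↦ N)
    convert this using 2 with N
    rw [← one_sub_T_mul_geom_one, subsetGen_one]
    ring
  · have := ((ih (k - j) (by omega)).geom_mul j).mono (show _ ≤ k - 3 by omega)
    convert this using 2 with N
    ring

/-- The error made in replacing distinct by arbitrary entries: `k! e_k - p_1 ^ k`. -/
def remainder (N k : ℕ) : ℤ[T;T⁻¹] := (k.factorial : ℤ[T;T⁻¹]) * subsetGen N k - geom N 1 ^ k

lemma remainder_succ (N k : ℕ) : remainder N (k + 1) = geom N 1 * remainder N k +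
    (k.factorial : ℤ[T;T⁻¹]) *
      ∑ j ∈ Icc 2 (k + 1), (-1) ^ (j + 1) * (subsetGen N (k + 1 - j) * geom N j) := by
  have h := newton N (k + 1)
  rw [← add_sum_Ioc_eq_sum_Icc (by omega), ← Finset.Icc_add_one_left_eq_Ioc] at h
  simp only [Nat.add_sub_cancel, Nat.reduceAdd] at h
  simp only [remainder, Nat.factorial_succ]
  push_cast at h ⊢
  linear_combination (k.factorial : ℤ[T;T⁻¹]) * h

lemma CoeffBigO.mul_remainder_succ {A : ℕ → ℤ[T;T⁻¹]} {k a : ℕ}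
    (h1 : CoeffBigO (fun N ↦ A N * (geom N 1 * remainder N k)) a)
    (h : ∀ j, 2 ≤ j → j ≤ k + 1 →
      CoeffBigO (fun N ↦ A N * (subsetGen N (k + 1 - j) * geom N j)) a) :
    CoeffBigO (fun N ↦ A N * remainder N (k + 1)) a := by
  have : ∀ j ∈ Icc 2 (k + 1), CoeffBigO (fun N ↦
      (((-1) ^ (j + 1) : ℤ) : ℤ[T;T⁻¹]) * (A N * (subsetGen N (k + 1 - j) * geom N j))) a :=
    fun j hj ↦ (h j (mem_Icc.1 hj).1 (mem_Icc.1 hj).2).intCast_mul _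
  convert h1.add ((CoeffBigO.sum _ this).intCast_mul k.factorial) using 2 with N
  rw [remainder_succ, mul_add, mul_left_comm (A N) (k.factorial : ℤ[T;T⁻¹]), mul_sum]
  push_cast
  congr 2
  refine sum_congr rfl fun j _ ↦ ?_
  ring

lemma coeffBigO_remainder (k : ℕ) : CoeffBigO (fun N ↦ remainder N (k + 2)) k := by
  suffices CoeffBigO (fun N ↦ 1 * remainder N (k + 1 + 1)) k by simpa using this
  refine CoeffBigO.mul_remainder_succ ?_ fun j hj hjk ↦ ?_
  · cases k with
    | zero => simpa [remainder, subsetGen_one] using CoeffBigO.zero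
    | succ k => simpa using (coeffBigO_remainder k).geom_mul 1
  · simp only [one_mul]
    rcases hjk.eq_or_lt with rfl | hlt
    · simpa [subsetGen_zero] using
        (coeffBigO_geom (j := k + 1 + 1) (by omega)).mono (Nat.zero_le _)
    · simp only [mul_comm (subsetGen _ _)]
      exact ((coeffBigO_subsetGen _).geom_mul j).mono (by omega)

lemma coeffBigO_diff_remainder (k : ℕ) :
    CoeffBigO (fun N ↦ (1 - T 1) * remainder N (k + 4)) (k + 1) := by
  refine CoeffBigO.mul_remainder_succ ?_ fun j hj hjk ↦ ?_
  · convert (coeffBigO_remainder (k + 1)).one_sub_T_mul fun N ↦ N using 2 with N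
    rw [← one_sub_T_mul_geom_one]
    ring
  · rcases hjk.eq_or_lt with rfl | hlt
    · simpa [subsetGen_zero] using ((coeffBigO_geom (j := k + 3 + 1) (by omega)).one_sub_T_mul
        fun _ ↦ 1).mono (Nat.zero_le _)
    · have := ((coeffBigO_diff_subsetGen (k + 3 + 1 - j)).geom_mul j).mono
        (show _ ≤ k + 1 by omega)
      convert this using 2 with N
      ring

lemma coeffBigO_diff_diff_remainder (k : ℕ) :
    CoeffBigO (fun N ↦ (1 - T 1) ^ 2 * remainder N (k + 5)) (k + 1) := by
  refine CoeffBigO.mul_remainder_succ ?_ fun j hj hjk ↦ ?_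
  · convert (coeffBigO_diff_remainder k).one_sub_T_mul fun N ↦ N using 2 with N
    rw [← one_sub_T_mul_geom_one]
    ring
  · rcases hjk.eq_or_lt with rfl | hlt
    · have := (((coeffBigO_geom (j := k + 4 + 1) (by omega)).one_sub_T_mul
        fun _ ↦ 1).one_sub_T_mul fun _ ↦ 1).mono (Nat.zero_le (k + 1))
      simpa [subsetGen_zero, ← mul_assoc, ← sq] using this
    · have := ((coeffBigO_diff_diff_subsetGen (k + 4 + 1 - j)).geom_mul j).mono
        (show _ ≤ k + 1 by omega)
      convert this using 2 with N
      ring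

lemma le_of_forall_sub_one_le {f : ℤ → ℤ} {c : ℤ} (hf : ∀ z, 2 * z ≤ c → f (z - 1) ≤ f z)
    {x y : ℤ} (hxy : x ≤ y) (hy : 2 * y ≤ c) : f x ≤ f y := by
  induction y, hxy using Int.leInduction with
  | base => exact le_rfl
  | succ y _ ih =>
    have := hf (y + 1) hy
    rw [add_sub_cancel_right] at this
    exact (ih (by omega)).trans this

lemma mul_le_sub_of_forall {f : ℤ → ℤ} {δ K y : ℤ} (r : ℕ)
    (h : ∀ i, y - r < i → i ≤ y → δ ≤ K * (f i - f (i - 1))) :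
    r * δ ≤ K * (f y - f (y - r)) := by
  induction r with
  | zero => simp
  | succ r ih =>
    have h1 := ih fun i hi hiy ↦ h i (by push_cast; omega) hiy
    have h2 := h (y - r) (by push_cast; omega) (by omega)
    rw [show y - ((r + 1 : ℕ) : ℤ) = y - r - 1 by push_cast; ring]
    push_cast
    linarith

lemma coeff_geom_pow_succ_sub (N k : ℕ) (z : ℤ) :
    (geom N 1 ^ (k + 1)).coeff z - (geom N 1 ^ (k + 1)).coeff (z - 1) =
      (geom N 1 ^ k).coeff z - (geom N 1 ^ k).coeff (z - N) := by
  rw [← coeff_one_sub_T_mul, ← coeff_one_sub_T_mul, ← one_sub_T_mul_geom_one, pow_succ']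
  congr 2
  ring

lemma coeff_geom_pow_mono (N k : ℕ) :
    ∀ z : ℤ, 2 * z ≤ k * ((N : ℤ) - 1) →
      (geom N 1 ^ k).coeff (z - 1) ≤ (geom N 1 ^ k).coeff z := by
  induction k with
  | zero =>
    intro z hz
    rw [pow_zero, ← T_zero, T_apply, T_apply]
    split_ifs <;> omega
  | succ k ih =>
    intro z hz
    rw [← sub_nonneg, coeff_geom_pow_succ_sub, sub_nonneg]
    push_cast at hz
    rw [add_mul, one_mul] at hz
    by_cases h : 2 * z ≤ k * ((N : ℤ) - 1)
    · exact le_of_forall_sub_one_le ih (by omega) h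
    · rw [← (palindromic_geom_pow N k).coeff z]
      exact le_of_forall_sub_one_le ih (by linarith) (by linarith)

set_option maxHeartbeats 400000 in
/-- Away from the lower end, the increments of the coefficients of `(1 + q + ⋯ + q ^ (N - 1)) ^ k`
are at least a constant times `N ^ (k - 3)` times the distance to the centre. -/
lemma coeff_geom_pow_growth (j : ℕ) : ∀ q : ℕ, 0 < q → ∃ K N₀ : ℕ, ∀ N : ℕ, N₀ ≤ N → ∀ z : ℤ,
    (N : ℤ) ≤ q * z → 2 * z ≤ (j + 2 : ℕ) * ((N : ℤ) - 1) →
    (N : ℤ) ^ j * ((j + 2 : ℕ) * ((N : ℤ) - 1) + 1 - 2 * z) ≤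
      K * N * ((geom N 1 ^ (j + 2)).coeff z - (geom N 1 ^ (j + 2)).coeff (z - 1)) := by
  induction j with
  | zero =>
    intro q hq
    refine ⟨2, 1, fun N hN z hz h2 ↦ ?_⟩
    rw [coeff_geom_pow_succ_sub, zero_add, pow_one, coeff_geom N one_pos, coeff_geom N one_pos]
    have hz0 : 0 < z := by
      by_contra! h
      have : (q : ℤ) * z ≤ 0 := mul_nonpos_of_nonneg_of_nonpos (by positivity) h
      omega
    push_cast at h2 ⊢
    rw [if_pos ⟨by omega, by omega, one_dvd _⟩, if_neg (by omega), pow_zero, one_mul]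
    linarith
  | succ j ih =>
    intro q hq
    obtain ⟨K, N₀, hK⟩ := ih (8 * q) (by omega)
    refine ⟨2 * K + (j + 3) * (32 * q) ^ 2 * K, max N₀ (32 * q), fun N hN z hz h2 ↦ ?_⟩
    have hN₀ : N₀ ≤ N := le_of_max_le_left hN
    have hNq : 32 * q ≤ N := le_of_max_le_right hN
    have hN0 : (0 : ℤ) < N := by exact_mod_cast (by omega : 0 < N)
    have hNq' : 32 * (q : ℤ) ≤ N := by exact_mod_cast hNq
    have hq' : (1 : ℤ) ≤ q := by exact_mod_cast hq
    rw [show j + 1 + 2 = (j + 2) + 1 by ring, coeff_geom_pow_succ_sub]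
    set t : ℤ → ℤ := fun z ↦ (geom N 1 ^ (j + 2)).coeff z with ht
    change _ ≤ _ * (t z - t (z - N))
    set c : ℤ := (j + 2 : ℕ) * ((N : ℤ) - 1) with hc
    have hc' : ((j + 2 + 1 : ℕ) : ℤ) * ((N : ℤ) - 1) = c + (N - 1) := by
      rw [hc]; push_cast; ring
    have h2' : 2 * z ≤ c + (N - 1) := by rw [← hc']; exact_mod_cast h2
    rw [hc']
    have hc2 : 2 * ((N : ℤ) - 1) ≤ c := by
      rw [hc]
      refine mul_le_mul_of_nonneg_right ?_ (by omega)
      push_cast; omega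
    have hmono : ∀ z, 2 * z ≤ c → t (z - 1) ≤ t z := coeff_geom_pow_mono N (j + 2)
    have hrefl : t (c - z) = t z := (palindromic_geom_pow N (j + 2)).coeff z
    have hz0 : 0 < z := by
      by_contra! h
      have : (q : ℤ) * z ≤ 0 := mul_nonpos_of_nonneg_of_nonpos (by positivity) h
      omega
    have hm0 : 0 < c + (N - 1) + 1 - 2 * z := by omega
    have hmN : c + (N - 1) + 1 - 2 * z ≤ (j + 3) * N := by
      rw [hc]; push_cast; nlinarith
    have hD : 0 ≤ t z - t (z - N) := by
      rw [sub_nonneg]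
      by_cases h : 2 * z ≤ c
      · exact le_of_forall_sub_one_le hmono (by omega) h
      · rw [← hrefl]
        exact le_of_forall_sub_one_le hmono (by omega) (by omega)
    by_cases hm : 2 * (c + (N - 1) + 1 - 2 * z) ≤ N
    · obtain ⟨r, hr⟩ := Int.eq_ofNat_of_zero_le hm0.le
      have hr' : ((r : ℕ) : ℤ) = c + (N - 1) + 1 - 2 * z := by omega
      have key := mul_le_sub_of_forall (f := t) (δ := (N : ℤ) ^ j) (K := 2 * K) (y := c - z) r
        fun i hi hi' ↦ by
          have h3 : (N : ℤ) ≤ 8 * i := by omega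
          have h4 : (N : ℤ) ≤ (8 * q : ℕ) * i := by push_cast; nlinarith
          have := hK N hN₀ i h4 (by omega)
          have h5 : (N : ℤ) ≤ 2 * (c + 1 - 2 * i) := by omega
          have h6 : (N : ℤ) ^ j * N ≤ (N : ℤ) ^ j * (2 * (c + 1 - 2 * i)) :=
            mul_le_mul_of_nonneg_left h5 (by positivity)
          refine le_of_mul_le_mul_right ?_ hN0
          calc (N : ℤ) ^ j * N ≤ 2 * ((N : ℤ) ^ j * (c + 1 - 2 * i)) := by linarith
            _ ≤ 2 * (K * N * (t i - t (i - 1))) := by linarith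
            _ = 2 * K * (t i - t (i - 1)) * N := by ring
      rw [hrefl, show c - z - (r : ℤ) = z - N by omega, hr'] at key
      have h7 := mul_le_mul_of_nonneg_right key hN0.le
      have h8 : 0 ≤ ((j + 3 : ℕ) * (32 * q : ℕ) ^ 2 * K : ℤ) * N * (t z - t (z - N)) := by
        positivity
      push_cast at h8 ⊢
      rw [pow_succ]
      linarith
    · obtain ⟨r, hr1, hr2⟩ : ∃ r : ℕ, 16 * q * r ≤ N ∧ N ≤ 32 * q * r := by
        refine ⟨N / (16 * q), Nat.mul_div_le N (16 * q), ?_⟩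
        have := Nat.lt_mul_div_succ N (show 0 < 16 * q by omega)
        nlinarith
      have hr1' : 16 * (q : ℤ) * r ≤ N := by exact_mod_cast hr1
      have hr2' : (N : ℤ) ≤ 32 * q * r := by exact_mod_cast hr2
      have hr3 : 16 * (r : ℤ) ≤ N := by nlinarith
      obtain ⟨h, hh, hhz, hhc, hhq, hhN⟩ : ∃ h, t h = t z ∧ h ≤ z ∧ 2 * h ≤ c ∧
          (N : ℤ) ≤ 3 * q * h ∧ z - N ≤ h - 2 * r := by
        by_cases h : 2 * z ≤ c
        · exact ⟨z, rfl, le_rfl, h, by nlinarith, by omega⟩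
        · refine ⟨c - z, hrefl, by omega, by omega, ?_, by omega⟩
          have h9 : (N : ℤ) ≤ 3 * (c - z) := by omega
          nlinarith
      have key := mul_le_sub_of_forall (f := t) (δ := (N : ℤ) ^ j * r) (K := K * N) (y := h - r) r
        fun i hi hi' ↦ by
          have h4 : (N : ℤ) ≤ (8 * q : ℕ) * i := by
            have : (q : ℤ) * (h - 2 * r) ≤ q * i := mul_le_mul_of_nonneg_left (by omega) (by omega)
            push_cast
            linarith
          have h5 := hK N hN₀ i h4 (by omega)
          refine le_trans (mul_le_mul_of_nonneg_left ?_ (by positivity)) h5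
          omega
      have h10 : t (h - r) ≤ t z := by
        rw [← hh]
        exact le_of_forall_sub_one_le hmono (by omega) hhc
      have h11 : t (z - N) ≤ t (h - r - r) :=
        le_of_forall_sub_one_le hmono (by omega) (by omega)
      have h12 : (r : ℤ) * ((N : ℤ) ^ j * r) ≤ K * N * (t z - t (z - N)) :=
        key.trans (mul_le_mul_of_nonneg_left (by omega) (by positivity))
      have h13 : (N : ℤ) ^ (j + 1) * (c + (N - 1) + 1 - 2 * z) ≤
          (j + 3) * (32 * q) ^ 2 * (r * ((N : ℤ) ^ j * r)) := by
        calc (N : ℤ) ^ (j + 1) * (c + (N - 1) + 1 - 2 * z)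
            ≤ (N : ℤ) ^ (j + 1) * ((j + 3) * N) := mul_le_mul_of_nonneg_left hmN (by positivity)
          _ = (j + 3) * (N : ℤ) ^ j * (N * N) := by ring
          _ ≤ (j + 3) * (N : ℤ) ^ j * ((32 * q * r) * (32 * q * r)) := by gcongr
          _ = _ := by ring
      have h14 : ((j : ℤ) + 3) * (32 * q) ^ 2 * (r * ((N : ℤ) ^ j * r)) ≤
          (j + 3) * (32 * q) ^ 2 * (K * N * (t z - t (z - N))) := by gcongr
      have h15 : 0 ≤ 2 * (K : ℤ) * N * (t z - t (z - N)) := by positivity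
      push_cast
      linarith

/-- Increments of a palindromic sequence are controlled by its second differences and the distance
to the centre. -/
lemma two_mul_abs_diff_le {f : ℤ → ℤ} {d B : ℤ} (hf : ∀ z, f (d - z) = f z)
    (hB : ∀ z, |f z - f (z - 1) - (f (z - 1) - f (z - 2))| ≤ B) {z : ℤ} (hz : 2 * z ≤ d) :
    2 * |f z - f (z - 1)| ≤ (d + 1 - 2 * z) * B := by
  have key (r : ℕ) : |f (z + r) - f (z + r - 1) - (f z - f (z - 1))| ≤ r * B := by
    induction r with
    | zero => simp
    | succ r ih =>
      have h := hB (z + r + 1)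
      rw [add_sub_cancel_right, show z + r + 1 - 2 = z + r - 1 by ring] at h
      push_cast
      rw [← add_assoc, add_sub_cancel_right]
      rw [abs_le] at *
      constructor <;> linarith
  obtain ⟨r, hr⟩ := Int.eq_ofNat_of_zero_le (show 0 ≤ d + 1 - 2 * z by omega)
  have h := key r
  rw [show z + (r : ℤ) = d - (z - 1) by omega, hf, show d - (z - 1) - 1 = d - z by ring, hf] at h
  rw [hr]
  refine le_trans (le_of_eq ?_) h
  rw [show f (z - 1) - f z - (f z - f (z - 1)) = -(2 * (f z - f (z - 1))) by ring, abs_neg,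
    abs_mul, abs_two]

/-- The generating function, by sum of elements, of the `k`-subsets of `{1, …, n}`. -/
def posSubsetGen (n k : ℕ) : ℤ[T;T⁻¹] :=
  ∑ s ∈ powersetCard k (Icc 1 n), T ((∑ i ∈ s, i : ℕ) : ℤ)

lemma subsetGen_succ_succ (n k : ℕ) :
    subsetGen (n + 1) (k + 1) = posSubsetGen n (k + 1) + posSubsetGen n k := by
  have h0 : 0 ∉ Icc 1 n := by simp
  have h : range (n + 1) = insert 0 (Icc 1 n) := by
    ext i; simp only [mem_range, mem_insert, mem_Icc]; omega
  rw [subsetGen, h, powersetCard_succ_insert h0, sum_union, sum_image]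
  · congr 1
    refine sum_congr rfl fun s hs ↦ ?_
    rw [sum_insert fun h ↦ h0 ((mem_powersetCard.1 hs).1 h), zero_add]
  · exact fun s hs t ht hst ↦ by
      rw [← erase_insert fun h ↦ h0 ((mem_powersetCard.1 hs).1 h), hst,
        erase_insert fun h ↦ h0 ((mem_powersetCard.1 ht).1 h)]
  · rw [disjoint_left]
    intro s hs ht
    obtain ⟨t, -, rfl⟩ := mem_image.1 ht
    exact h0 ((mem_powersetCard.1 hs).1 (mem_insert_self 0 t))

lemma posSubsetGen_eq (n k : ℕ) : posSubsetGen n k = T (k : ℤ) * subsetGen n k := by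
  have h : Icc 1 n = (range n).map (addRightEmbedding 1) := by
    rw [range_eq_Ico, Finset.map_add_right_Ico]
    ext i; simp only [mem_Icc, mem_Ico]; omega
  rw [posSubsetGen, h, powersetCard_map, sum_map, subsetGen, mul_sum]
  refine sum_congr rfl fun s hs ↦ ?_
  rw [← T_add, RelEmbedding.coe_toEmbedding, mapEmbedding_apply, sum_map]
  simp only [addRightEmbedding_apply, sum_add_distrib, sum_const, smul_eq_mul, mul_one,
    (mem_powersetCard.1 hs).2]
  push_cast
  rw [add_comm]

lemma coeff_subsetGen_succ_succ (n k : ℕ) (z : ℤ) : (subsetGen (n + 1) (k + 1)).coeff z =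
    (subsetGen n (k + 1)).coeff (z - (k + 1)) + (subsetGen n k).coeff (z - k) := by
  rw [subsetGen_succ_succ, posSubsetGen_eq, posSubsetGen_eq, AddMonoidAlgebra.coeff_add,
    Finsupp.add_apply, coeff_T_mul, coeff_T_mul, Nat.cast_succ]

/-- The sum of `subsetGen N k` over `k ≤ b` of the same parity as `b`. -/
def stairGen (N : ℕ) : ℕ → ℤ[T;T⁻¹]
  | 0 => subsetGen N 0
  | 1 => subsetGen N 1
  | b + 2 => subsetGen N (b + 2) + stairGen N b

lemma stairGen_succ_eq (n b : ℕ) :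
    stairGen (n + 1) b = ∑ r ∈ range (b + 1), posSubsetGen n r := by
  induction b using Nat.twoStepInduction with
  | zero => simp [stairGen, posSubsetGen_eq, subsetGen_zero]
  | one => rw [stairGen, subsetGen_succ_succ, sum_range_succ, sum_range_one, add_comm]
  | more b ih _ =>
    rw [stairGen, ih, subsetGen_succ_succ, sum_range_succ _ (b + 2), sum_range_succ _ (b + 1)]
    ring

lemma natCast_truncStaircaseCount (n b l : ℕ) :
    (truncStaircaseCount n b l : ℤ) = (stairGen (n + 1) b).coeff (l : ℤ) := by
  rw [stairGen_succ_eq, coeff_finset_sum, truncStaircaseCount,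
    card_eq_sum_card_fiberwise (f := Finset.card) (t := range (b + 1))]
  · push_cast
    refine sum_congr rfl fun r hr ↦ ?_
    rw [posSubsetGen, coeff_finset_sum]
    simp only [T_apply, Nat.cast_inj, sum_boole]
    apply congrArg Finset.card
    ext s
    have := mem_range.1 hr
    simp only [mem_filter, mem_powerset, mem_powersetCard, id]
    constructor
    · rintro ⟨⟨h1, h2, h3⟩, h4⟩
      exact ⟨⟨h1, h4⟩, h3⟩
    · rintro ⟨⟨h1, h4⟩, h3⟩
      exact ⟨⟨h1, by omega, h3⟩, h4⟩
  · intro s hs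
    have := (mem_filter.1 hs).2.1
    simp only [coe_range, Set.mem_Iio]
    omega

lemma coeff_subsetGen_of_neg (N k : ℕ) {z : ℤ} (hz : z < 0) : (subsetGen N k).coeff z = 0 := by
  rw [subsetGen, coeff_finset_sum]
  exact sum_eq_zero fun s _ ↦ by rw [T_apply, if_neg (by omega)]

lemma coeff_subsetGen_of_lt (N k : ℕ) {z : ℤ} (hz : k * ((N : ℤ) - 1) < z) :
    (subsetGen N k).coeff z = 0 := by
  rw [← (palindromic_subsetGen N k).coeff]
  exact coeff_subsetGen_of_neg N k (by omega)

lemma diff_subsetGen_reflect (N k : ℕ) (z : ℤ) :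
    (subsetGen N k).coeff (k * ((N : ℤ) - 1) + 1 - z) -
        (subsetGen N k).coeff (k * ((N : ℤ) - 1) + 1 - z - 1) =
      -((subsetGen N k).coeff z - (subsetGen N k).coeff (z - 1)) := by
  rw [← (palindromic_subsetGen N k).coeff z, ← (palindromic_subsetGen N k).coeff (z - 1), neg_sub]
  congr 2 <;> ring

lemma coeff_subsetGen_mono_left (N : ℕ) : ∀ (k : ℕ) (z : ℤ), z < N →
    (subsetGen N (k + 1)).coeff (z - 1) ≤ (subsetGen N (k + 1)).coeff z := by
  induction N with
  | zero =>
    intro k z hz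
    rw [coeff_subsetGen_of_neg _ _ (by omega), coeff_subsetGen_of_neg _ _ (by omega)]
  | succ N ih =>
    intro k z hz
    push_cast at hz
    rcases k with _ | k
    · rw [zero_add, subsetGen_one, coeff_geom _ one_pos, coeff_geom _ one_pos]
      simp only [Nat.cast_one, one_mul, one_dvd, and_true]
      push_cast
      split_ifs <;> omega
    · rw [coeff_subsetGen_succ_succ, coeff_subsetGen_succ_succ]
      push_cast
      rw [sub_right_comm z 1, sub_right_comm z 1]
      exact add_le_add (ih _ _ (by omega)) (ih _ _ (by omega))

lemma coeff_stairGen_zero (N : ℕ) (z : ℤ) : (stairGen N 0).coeff z = if z = 0 then 1 else 0 := by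
  rw [stairGen, subsetGen_zero, ← T_zero, T_apply]
  simp only [eq_comm]

lemma coeff_subsetGen_two_one {N : ℕ} (hN : 2 ≤ N) :
    (subsetGen N 2).coeff 0 + 1 = (subsetGen N 2).coeff 1 := by
  have h (z : ℤ) : 2 * (subsetGen N 2).coeff z =
      (geom N 1 ^ 2).coeff z - (geom N 2).coeff z := by
    rw [← Nat.cast_two, ← coeff_natCast_mul, Nat.cast_two, two_mul_subsetGen_two,
      AddMonoidAlgebra.coeff_sub, Finsupp.sub_apply]
  have h1 := coeff_geom_pow_succ_sub N 1 1
  have h2 := h 0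
  have h3 := h 1
  simp only [pow_one, one_add_one_eq_two, sub_self] at h1
  rw [coeff_geom N one_pos, coeff_geom N one_pos, if_pos ⟨by omega, by omega, by simp⟩,
    if_neg (by omega)] at h1
  rw [coeff_geom N two_pos, if_pos ⟨by omega, by omega, by simp⟩] at h2
  rw [coeff_geom N two_pos, if_neg (by omega)] at h3
  omega

lemma coeff_stairGen_succ_succ (N b : ℕ) (z : ℤ) : (stairGen N (b + 2)).coeff z =
    (subsetGen N (b + 2)).coeff z + (stairGen N b).coeff z := by
  rw [stairGen, AddMonoidAlgebra.coeff_add, Finsupp.add_apply]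

lemma coeff_stairGen_mono_left {N : ℕ} (hN : 2 ≤ N) (b : ℕ) {z : ℤ} (hz : 1 ≤ z) (hzN : z < N) :
    (stairGen N (b + 1)).coeff (z - 1) ≤ (stairGen N (b + 1)).coeff z := by
  induction b using Nat.twoStepInduction with
  | zero => exact coeff_subsetGen_mono_left N 0 z hzN
  | one =>
    rw [coeff_stairGen_succ_succ, coeff_stairGen_succ_succ, coeff_stairGen_zero,
      coeff_stairGen_zero]
    have h1 := coeff_subsetGen_mono_left N 1 z hzN
    have h2 := coeff_subsetGen_two_one hN
    rcases hz.eq_or_lt with rfl | hz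
    · simp only [sub_self, zero_add] at *
      simp; omega
    · rw [if_neg (by omega), if_neg (by omega)]
      simpa using h1
  | more b ih _ =>
    rw [coeff_stairGen_succ_succ, coeff_stairGen_succ_succ]
    exact add_le_add (coeff_subsetGen_mono_left N (b + 2) z hzN) ih

lemma coeff_stairGen_of_lt {N : ℕ} (hN : 1 ≤ N) (b : ℕ) {z : ℤ} (hz : b * ((N : ℤ) - 1) < z) :
    (stairGen N b).coeff z = 0 := by
  induction b using Nat.twoStepInduction with
  | zero => exact coeff_subsetGen_of_lt N 0 hz
  | one => exact coeff_subsetGen_of_lt N 1 hz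
  | more b ih _ =>
    rw [coeff_stairGen_succ_succ, coeff_subsetGen_of_lt N _ hz, ih, add_zero]
    push_cast at hz
    nlinarith

lemma coeffBigO_diff_stairGen (b : ℕ) :
    CoeffBigO (fun N ↦ (1 - T 1) * stairGen N b) (b - 2) := by
  induction b using Nat.twoStepInduction with
  | zero => exact coeffBigO_diff_subsetGen 0
  | one => exact coeffBigO_diff_subsetGen 1
  | more b ih _ =>
    convert (coeffBigO_diff_subsetGen (b + 2)).add (ih.mono (by omega)) using 2 with N
    rw [stairGen, mul_add]

/-- In the middle range, the increments of `subsetGen N (j + 5)` dominate all increments of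
`stairGen N (j + 3)`. -/
lemma exists_abs_diff_stairGen_le (j : ℕ) : ∃ N₀ : ℕ, ∀ N : ℕ, N₀ ≤ N → ∀ z : ℤ, (N : ℤ) ≤ z →
    2 * z ≤ (j + 5 : ℕ) * ((N : ℤ) - 1) → ∀ w : ℤ,
    |(stairGen N (j + 3)).coeff w - (stairGen N (j + 3)).coeff (w - 1)| ≤
      (subsetGen N (j + 5)).coeff z - (subsetGen N (j + 5)).coeff (z - 1) := by
  obtain ⟨K, N₀, hK⟩ := coeff_geom_pow_growth (j + 3) 1 one_pos
  obtain ⟨C, hC⟩ := coeffBigO_diff_diff_remainder j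
  obtain ⟨D, hD⟩ := coeffBigO_diff_stairGen (j + 3)
  refine ⟨N₀ + K * C + 2 * K * (j + 5).factorial * D + 1, fun N hN z hz hz2 w ↦ ?_⟩
  have hN1 : 1 ≤ N := by omega
  have hN0 : (0 : ℤ) < N := by exact_mod_cast hN1
  have hDw := hD N hN1 w
  rw [coeff_one_sub_T_mul, show j + 3 - 2 = j + 1 by omega] at hDw
  refine hDw.trans ?_
  have hgrow := hK N (by omega) z (by simpa using hz) hz2
  have hR (z : ℤ) : (remainder N (j + 5)).coeff z =
      (j + 5).factorial * (subsetGen N (j + 5)).coeff z - (geom N 1 ^ (j + 5)).coeff z := by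
    rw [remainder, AddMonoidAlgebra.coeff_sub, Finsupp.sub_apply, coeff_natCast_mul]
  have hRle := two_mul_abs_diff_le (f := fun z ↦ (remainder N (j + 5)).coeff z)
    (fun z ↦ by
      rw [hR, hR, (palindromic_subsetGen N (j + 5)).coeff z,
        (palindromic_geom_pow N (j + 5)).coeff z])
    (fun z ↦ by
      have h : |((1 - T 1) ^ 2 * remainder N (j + 5)).coeff z| ≤ C * (N : ℤ) ^ (j + 1) := hC N hN1 z
      rwa [sq, mul_assoc, coeff_one_sub_T_mul, coeff_one_sub_T_mul, coeff_one_sub_T_mul,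
        show z - 1 - 1 = z - 2 by ring] at h) hz2
  simp only [hR] at hRle
  rw [show j + 3 + 2 = j + 5 by ring] at hgrow
  set m : ℤ := (j + 5 : ℕ) * ((N : ℤ) - 1) + 1 - 2 * z with hm
  have hm1 : 1 ≤ m := by omega
  set x := (geom N 1 ^ (j + 5)).coeff z
  set x' := (geom N 1 ^ (j + 5)).coeff (z - 1)
  set y := (subsetGen N (j + 5)).coeff z
  set y' := (subsetGen N (j + 5)).coeff (z - 1)
  set F : ℤ := ((j + 5).factorial : ℤ) with hF
  have hF0 : 0 < F := by rw [hF]; exact_mod_cast Nat.factorial_pos _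
  have hK0 : (0 : ℤ) < K := by
    rcases Nat.eq_zero_or_pos K with rfl | h
    · have : 0 < (N : ℤ) ^ (j + 3) * m := by positivity
      simp only [Nat.cast_zero, zero_mul] at hgrow
      omega
    · exact_mod_cast h
  have hKC : (K : ℤ) * C ≤ N := by
    have : K * C ≤ N := by omega
    exact_mod_cast this
  have hKD : 2 * K * F * D ≤ N := by
    have : 2 * K * (j + 5).factorial * D ≤ N := by omega
    rw [hF]
    exact_mod_cast this
  have hRl := (abs_le.1 (show |2 * (F * y - x - (F * y' - x'))| ≤ m * (C * (N : ℤ) ^ (j + 1)) by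
    rw [abs_mul, abs_two]; exact hRle)).1
  have h1 : K * N * (-(m * (C * (N : ℤ) ^ (j + 1)))) ≤ K * N * (2 * (F * y - x - (F * y' - x'))) :=
    mul_le_mul_of_nonneg_left hRl (by positivity)
  have h2 : K * C * (m * (N : ℤ) ^ (j + 2)) ≤ N * (m * (N : ℤ) ^ (j + 2)) :=
    mul_le_mul_of_nonneg_right hKC (by positivity)
  have h3 : 2 * K * F * D * (N : ℤ) ^ (j + 2) ≤ N * (N : ℤ) ^ (j + 2) :=
    mul_le_mul_of_nonneg_right hKD (by positivity)
  have h4 : 1 * (N * (N : ℤ) ^ (j + 2)) ≤ m * (N * (N : ℤ) ^ (j + 2)) :=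
    mul_le_mul_of_nonneg_right hm1 (by positivity)
  refine le_of_mul_le_mul_left (a := 2 * K * N * F) ?_ (by positivity)
  have e1 : (N : ℤ) ^ (j + 3) = N * (N : ℤ) ^ (j + 2) := by ring
  have e2 : (N : ℤ) ^ (j + 2) = N * (N : ℤ) ^ (j + 1) := by ring
  rw [e1] at hgrow
  calc 2 * K * N * F * (D * (N : ℤ) ^ (j + 1)) = 2 * K * F * D * (N : ℤ) ^ (j + 2) := by
        rw [e2]; ring
    _ ≤ m * (N * (N : ℤ) ^ (j + 2)) := by linarith
    _ ≤ 2 * (m * (N * (N : ℤ) ^ (j + 2))) - K * C * (m * (N : ℤ) ^ (j + 2)) := by linarith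
    _ ≤ 2 * (K * N * (x - x')) - K * C * (m * (N : ℤ) ^ (j + 2)) := by linarith
    _ = 2 * (K * N * (x - x')) + K * N * (-(m * (C * (N : ℤ) ^ (j + 1)))) := by rw [e2]; ring
    _ ≤ 2 * (K * N * (x - x')) + K * N * (2 * (F * y - x - (F * y' - x'))) := by linarith
    _ = _ := by ring

/-- The sign conditions on increments in the range `N ≤ z ≤ (b + 2) * (N - 1) / 2` that yield
unimodality of the coefficients of `stairGen N (b + 2)`. -/
def MiddleCondition (N b : ℕ) : Prop :=
  ∀ z : ℤ, (N : ℤ) ≤ z → 2 * z ≤ (b + 2 : ℕ) * ((N : ℤ) - 1) →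
    (stairGen N b).coeff (z - 1) - (stairGen N b).coeff z ≤
        (subsetGen N (b + 2)).coeff z - (subsetGen N (b + 2)).coeff (z - 1) ∧
      (stairGen N b).coeff ((b + 2 : ℕ) * ((N : ℤ) - 1) + 1 - z) -
          (stairGen N b).coeff ((b + 2 : ℕ) * ((N : ℤ) - 1) + 1 - z - 1) ≤
        (subsetGen N (b + 2)).coeff z - (subsetGen N (b + 2)).coeff (z - 1)

lemma exists_middleCondition_add_three (j : ℕ) :
    ∃ N₀ : ℕ, ∀ N : ℕ, N₀ ≤ N → MiddleCondition N (j + 3) := by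
  obtain ⟨N₀, h⟩ := exists_abs_diff_stairGen_le j
  refine ⟨N₀, fun N hN z hz hz2 ↦ ⟨?_, (le_abs_self _).trans (h N hN z hz hz2 _)⟩⟩
  rw [← neg_sub]
  exact (neg_le_abs _).trans (h N hN z hz hz2 z)

lemma middleCondition_zero (N : ℕ) : MiddleCondition N 0 := by
  intro z hz hz2
  push_cast at hz2
  omega

lemma coeff_stairGen_mono {N b : ℕ} (hN : 2 ≤ N) (h : MiddleCondition N b) {z : ℤ} (hz : 1 ≤ z)
    (hz2 : 2 * z ≤ (b + 2 : ℕ) * ((N : ℤ) - 1)) :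
    (stairGen N (b + 2)).coeff (z - 1) ≤ (stairGen N (b + 2)).coeff z := by
  rcases lt_or_ge z N with hzN | hzN
  · exact coeff_stairGen_mono_left hN (b + 1) hz hzN
  · rw [coeff_stairGen_succ_succ, coeff_stairGen_succ_succ]
    linarith [(h z hzN hz2).1]

lemma coeff_stairGen_anti {N b : ℕ} (hN : 2 ≤ N) (h : MiddleCondition N b) {z : ℤ}
    (hz2 : (b + 2 : ℕ) * ((N : ℤ) - 1) + 2 ≤ 2 * z) :
    (stairGen N (b + 2)).coeff z ≤ (stairGen N (b + 2)).coeff (z - 1) := by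
  rw [coeff_stairGen_succ_succ, coeff_stairGen_succ_succ]
  obtain ⟨w, hw⟩ : ∃ w, w = (b + 2 : ℕ) * ((N : ℤ) - 1) + 1 - z := ⟨_, rfl⟩
  have hwz : z = (b + 2 : ℕ) * ((N : ℤ) - 1) + 1 - w := by omega
  have hr := diff_subsetGen_reflect N (b + 2) w
  rw [← hwz] at hr
  rcases lt_or_ge w N with hwN | hwN
  · have h1 := coeff_subsetGen_mono_left N (b + 1) w hwN
    have h2 : (b : ℤ) * (N - 1) < z - 1 := by
      rw [hwz]
      push_cast
      have : (2 : ℤ) ≤ N := by exact_mod_cast hN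
      linarith
    rw [coeff_stairGen_of_lt (by omega) b h2, coeff_stairGen_of_lt (by omega) b (by omega)]
    rw [show b + 1 + 1 = b + 2 by ring] at h1
    linarith
  · have h1 := (h w hwN (by omega)).2
    rw [← hwz] at h1
    linarith

lemma unimodal_of_diff {n b : ℕ} (hbn : b ≤ n)
    (hinc : ∀ z : ℤ, 1 ≤ z → 2 * z ≤ b * (n : ℤ) →
      (stairGen (n + 1) b).coeff (z - 1) ≤ (stairGen (n + 1) b).coeff z)
    (hdec : ∀ z : ℤ, b * (n : ℤ) + 2 ≤ 2 * z →
      (stairGen (n + 1) b).coeff z ≤ (stairGen (n + 1) b).coeff (z - 1)) :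
    ∃ k : ℕ, k ≤ b * n - b * (b - 1) / 2 ∧
      (∀ i : ℕ, i < k → truncStaircaseCount n b i ≤ truncStaircaseCount n b (i + 1)) ∧
      (∀ i : ℕ, k ≤ i → i < b * n - b * (b - 1) / 2 →
        truncStaircaseCount n b (i + 1) ≤ truncStaircaseCount n b i) := by
  have hinc' (i : ℕ) (hi : 2 * (i + 1) ≤ b * n) :
      truncStaircaseCount n b i ≤ truncStaircaseCount n b (i + 1) := by
    zify
    rw [natCast_truncStaircaseCount, natCast_truncStaircaseCount]
    have := hinc (i + 1 : ℕ) (by omega) (by exact_mod_cast hi)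
    simpa using this
  have hdec' (i : ℕ) (hi : b * n ≤ 2 * i) :
      truncStaircaseCount n b (i + 1) ≤ truncStaircaseCount n b i := by
    zify
    rw [natCast_truncStaircaseCount, natCast_truncStaircaseCount]
    have h2 : ((b * n : ℕ) : ℤ) ≤ (2 * i : ℕ) := by exact_mod_cast hi
    have := hdec (i + 1 : ℕ) (by push_cast at h2 ⊢; linarith)
    simpa using this
  have hle : b * (b - 1) ≤ b * n := Nat.mul_le_mul_left b (by omega)
  by_cases h : truncStaircaseCount n b (b * n / 2) ≤ truncStaircaseCount n b (b * n / 2 + 1)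
  · refine ⟨(b * n + 1) / 2, by omega, fun i hi ↦ ?_, fun i hi _ ↦ hdec' i (by omega)⟩
    by_cases hi2 : 2 * (i + 1) ≤ b * n
    · exact hinc' i hi2
    · rwa [show i = b * n / 2 by omega]
  · refine ⟨b * n / 2, by omega, fun i hi ↦ hinc' i (by omega), fun i hi _ ↦ ?_⟩
    rcases hi.eq_or_lt with rfl | hi
    · omega
    · exact hdec' i (by omega)

lemma coeff_geom_nonneg (N : ℕ) {j : ℕ} (hj : 0 < j) (z : ℤ) : 0 ≤ (geom N j).coeff z := by
  rw [coeff_geom N hj]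
  split_ifs <;> simp

lemma coeff_geom_le_one (N : ℕ) {j : ℕ} (hj : 0 < j) (z : ℤ) : (geom N j).coeff z ≤ 1 := by
  rw [coeff_geom N hj]
  split_ifs <;> simp

lemma coeff_geom_of_neg (N : ℕ) {j : ℕ} (hj : 0 < j) {z : ℤ} (hz : z < 0) :
    (geom N j).coeff z = 0 := by
  rw [coeff_geom N hj, if_neg (by omega)]

lemma coeff_geom_mul_of_neg (N j : ℕ) {P : ℤ[T;T⁻¹]} (hP : ∀ z < 0, P.coeff z = 0) {z : ℤ}
    (hz : z < 0) : (geom N j * P).coeff z = 0 := by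
  rw [coeff_geom_mul]
  exact sum_eq_zero fun i _ ↦ hP _ (by omega)

lemma coeff_geom_mul_sub (N j : ℕ) (P : ℤ[T;T⁻¹]) (z : ℤ) :
    (geom N j * P).coeff z - (geom N j * P).coeff (z - j) =
      P.coeff z - P.coeff (z - (N * j : ℕ)) := by
  rw [← coeff_one_sub_T_mul, ← coeff_one_sub_T_mul, ← one_sub_T_mul_geom, mul_assoc]

lemma coeff_geom_one_mul_sub (N : ℕ) (P : ℤ[T;T⁻¹]) (z : ℤ) :
    (geom N 1 * P).coeff z - (geom N 1 * P).coeff (z - 1) = P.coeff z - P.coeff (z - N) := by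
  simpa using coeff_geom_mul_sub N 1 P z

lemma coeff_geom_sq (N : ℕ) {z : ℤ} (hz : -1 ≤ z) (hzN : z < 2 * N) :
    (geom N 1 * geom N 1).coeff z = if z < N then z + 1 else 2 * N - 1 - z := by
  induction z, hz using Int.leInduction with
  | base =>
    rw [coeff_geom_mul_of_neg N 1 (fun z hz ↦ coeff_geom_of_neg N one_pos hz) (by omega),
      if_pos (by omega)]
    rfl
  | succ z hz ih =>
    have h := coeff_geom_one_mul_sub N (geom N 1) (z + 1)
    rw [add_sub_cancel_right, ih (by omega), coeff_geom N one_pos, coeff_geom N one_pos] at h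
    simp only [Nat.cast_one, one_mul, one_dvd, and_true] at h
    split_ifs at h ⊢ <;> omega

lemma two_mul_coeff_geom_cube (N : ℕ) {z : ℤ} (hz : -1 ≤ z) (hzN : z < 2 * N) :
    2 * (geom N 1 * (geom N 1 * geom N 1)).coeff z = (z + 1) * (z + 2) -
      if z < N then 0 else 3 * ((z - N + 1) * (z - N + 2)) := by
  have hneg {z : ℤ} (hz : z < 0) : (geom N 1 * geom N 1).coeff z = 0 :=
    coeff_geom_mul_of_neg N 1 (fun z hz ↦ coeff_geom_of_neg N one_pos hz) hz
  induction z, hz using Int.leInduction with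
  | base =>
    rw [coeff_geom_mul_of_neg N 1 (fun z hz ↦ hneg hz) (by omega), if_pos (by omega)]
    rfl
  | succ z hz ih =>
    have h := coeff_geom_one_mul_sub N (geom N 1 * geom N 1) (z + 1)
    have ih := ih (by omega)
    rw [add_sub_cancel_right, coeff_geom_sq N (by omega) (by omega)] at h
    rcases lt_trichotomy (z + 1) N with hlt | heq | hgt
    · rw [hneg (z := z + 1 - N) (by omega), if_pos hlt] at h
      rw [if_pos (by omega)] at ih ⊢
      linarith
    · rw [coeff_geom_sq N (by omega) (by omega), if_neg (by omega), if_pos (by omega)] at h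
      rw [if_pos (by omega)] at ih
      rw [if_neg (by omega), ← heq]
      rw [← heq] at h
      linarith
    · rw [coeff_geom_sq N (by omega) (by omega), if_neg (by omega), if_pos (by omega)] at h
      rw [if_neg (by omega)] at ih ⊢
      linarith

lemma coeff_geom_one_mul_geom_two (N : ℕ) {z : ℤ} (hz : -1 ≤ z) (hzN : z < 2 * N) :
    (geom N 1 * geom N 2).coeff z = if z < N then z / 2 + 1 else z / 2 - (z - N) / 2 := by
  induction z, hz using Int.leInduction with
  | base =>
    rw [coeff_geom_mul_of_neg N 1 (fun z hz ↦ coeff_geom_of_neg N two_pos hz) (by omega),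
      if_pos (by omega)]
    rfl
  | succ z hz ih =>
    have h := coeff_geom_one_mul_sub N (geom N 2) (z + 1)
    rw [add_sub_cancel_right, ih (by omega), coeff_geom N two_pos, coeff_geom N two_pos] at h
    simp only [Nat.cast_ofNat] at h
    split_ifs at h ⊢ <;> omega

lemma coeff_geom_two_sq (N : ℕ) (z : ℕ) (hzN : z < 2 * N) :
    (geom N 2 * geom N 2).coeff (z : ℤ) = if 2 ∣ z then (z : ℤ) / 2 + 1 else 0 := by
  have hneg {z : ℤ} (hz : z < 0) : (geom N 2 * geom N 2).coeff z = 0 :=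
    coeff_geom_mul_of_neg N 2 (fun z hz ↦ coeff_geom_of_neg N two_pos hz) hz
  induction z using Nat.twoStepInduction with
  | zero =>
    have h := coeff_geom_mul_sub N 2 (geom N 2) 0
    rw [hneg (z := 0 - (2 : ℕ)) (by omega), sub_zero, coeff_geom N two_pos,
      coeff_geom N two_pos, if_pos (by omega), if_neg (by omega)] at h
    simpa using h
  | one =>
    have h := coeff_geom_mul_sub N 2 (geom N 2) 1
    rw [hneg (z := 1 - (2 : ℕ)) (by omega), sub_zero, coeff_geom N two_pos,
      coeff_geom N two_pos, if_neg (by omega), if_neg (by omega)] at h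
    simpa using h
  | more z ih _ =>
    have h := coeff_geom_mul_sub N 2 (geom N 2) (z + 2 : ℕ)
    rw [show ((z + 2 : ℕ) : ℤ) - (2 : ℕ) = z by omega, ih (by omega), coeff_geom N two_pos,
      coeff_geom N two_pos] at h
    simp only [Nat.cast_ofNat] at h
    split_ifs at h ⊢ <;> omega

lemma coeff_ofNat_mul (P : ℤ[T;T⁻¹]) (n : ℕ) [n.AtLeastTwo] (z : ℤ) :
    ((ofNat(n) : ℤ[T;T⁻¹]) * P).coeff z = ofNat(n) * P.coeff z := by
  simpa using coeff_natCast_mul P ofNat(n) z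

lemma two_mul_coeff_subsetGen_two (N : ℕ) (z : ℤ) : 2 * (subsetGen N 2).coeff z =
    (geom N 1 * geom N 1).coeff z - (geom N 2).coeff z := by
  have h := congrArg (fun P : ℤ[T;T⁻¹] ↦ P.coeff z) (two_mul_subsetGen_two N)
  rw [sq] at h
  simpa only [AddMonoidAlgebra.coeff_sub, Finsupp.sub_apply, coeff_ofNat_mul] using h

lemma six_mul_coeff_subsetGen_three (N : ℕ) (z : ℤ) : 6 * (subsetGen N 3).coeff z =
    (geom N 1 * (geom N 1 * geom N 1)).coeff z - 3 * (geom N 1 * geom N 2).coeff z +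
      2 * (geom N 3).coeff z := by
  have h := congrArg (fun P : ℤ[T;T⁻¹] ↦ P.coeff z) (six_mul_subsetGen_three N)
  rw [show geom N 1 ^ 3 = geom N 1 * (geom N 1 * geom N 1) by ring] at h
  simpa only [AddMonoidAlgebra.coeff_sub, Finsupp.sub_apply, AddMonoidAlgebra.coeff_add,
    Finsupp.add_apply, coeff_ofNat_mul] using h

lemma coeff_subsetGen_four (N : ℕ) (z : ℤ) : 24 * (subsetGen N 4).coeff z =
    (geom N 1 * (geom N 1 * (geom N 1 * geom N 1))).coeff z -
      6 * (geom N 1 * (geom N 1 * geom N 2)).coeff z + 3 * (geom N 2 * geom N 2).coeff z +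
      8 * (geom N 1 * geom N 3).coeff z - 6 * (geom N 4).coeff z := by
  have h := congrArg (fun P : ℤ[T;T⁻¹] ↦ P.coeff z) (subsetGen_four N)
  rw [show geom N 1 ^ 4 = geom N 1 * (geom N 1 * (geom N 1 * geom N 1)) by ring] at h
  simpa only [AddMonoidAlgebra.coeff_sub, Finsupp.sub_apply, AddMonoidAlgebra.coeff_add,
    Finsupp.add_apply, coeff_ofNat_mul] using h

lemma coeff_stairGen_one (N : ℕ) (z : ℤ) :
    (stairGen N 1).coeff z = if 0 ≤ z ∧ z < N then 1 else 0 := by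
  rw [stairGen, subsetGen_one, coeff_geom N one_pos]
  simp

lemma middleCondition_one {N : ℕ} (hN : 8 ≤ N) : MiddleCondition N 1 := by
  intro z hz hz2
  push_cast at hz2
  have h1 := six_mul_coeff_subsetGen_three N z
  have h2 := six_mul_coeff_subsetGen_three N (z - 1)
  have h3 := coeff_geom_one_mul_sub N (geom N 1 * geom N 1) z
  have h4 := coeff_geom_one_mul_sub N (geom N 2) z
  rw [coeff_geom_sq N (by omega) (by omega), coeff_geom_sq N (by omega) (by omega),
    if_neg (by omega), if_pos (by omega)] at h3
  have h5 := coeff_geom_nonneg N two_pos (z - N)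
  have h6 := coeff_geom_le_one N two_pos z
  have h7 := coeff_geom_nonneg N three_pos z
  have h8 := coeff_geom_le_one N three_pos (z - 1)
  rw [coeff_stairGen_one, coeff_stairGen_one, coeff_stairGen_one, coeff_stairGen_one]
  push_cast
  constructor <;> split_ifs <;> omega

lemma diff_stairGen_two {N : ℕ} {z : ℤ} (hN : 2 ≤ N) (hz : (N : ℤ) ≤ z) :
    2 * ((stairGen N 2).coeff z - (stairGen N 2).coeff (z - 1)) =
      -(if z < 2 * N - 1 ∧ 2 ∣ z then 2 else 0) := by
  rw [coeff_stairGen_succ_succ, coeff_stairGen_succ_succ, coeff_stairGen_zero,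
    coeff_stairGen_zero, if_neg (by omega), if_neg (by omega), zero_add]
  have h1 := two_mul_coeff_subsetGen_two N z
  have h2 := two_mul_coeff_subsetGen_two N (z - 1)
  have h3 := coeff_geom_one_mul_sub N (geom N 1) z
  rw [coeff_geom N one_pos, coeff_geom N one_pos] at h3
  rw [coeff_geom N two_pos] at h1 h2
  simp only [Nat.cast_one, one_mul, one_dvd, and_true, Nat.cast_ofNat] at h1 h2 h3
  split_ifs at h1 h2 h3 ⊢ <;> omega

lemma diff_subsetGen_four {N : ℕ} (hN : 30 ≤ N) {z : ℤ} (hz : (N : ℤ) ≤ z) (hz2 : z < 2 * N - 1) :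
    (if 2 ∣ z then 1 else 0) ≤ (subsetGen N 4).coeff z - (subsetGen N 4).coeff (z - 1) := by
  have h1 := coeff_subsetGen_four N z
  have h2 := coeff_subsetGen_four N (z - 1)
  have h3 := coeff_geom_one_mul_sub N (geom N 1 * (geom N 1 * geom N 1)) z
  have h4 := coeff_geom_one_mul_sub N (geom N 1 * geom N 2) z
  have h5 := coeff_geom_one_mul_sub N (geom N 3) z
  have h6 := two_mul_coeff_geom_cube N (z := z) (by omega) (by omega)
  have h7 := two_mul_coeff_geom_cube N (z := z - N) (by omega) (by omega)
  rw [if_neg (by omega)] at h6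
  rw [if_pos (by omega), sub_zero] at h7
  rw [coeff_geom_one_mul_geom_two N (by omega) (by omega),
    coeff_geom_one_mul_geom_two N (by omega) (by omega), if_neg (by omega),
    if_pos (by omega)] at h4
  have h8 := coeff_geom_nonneg N three_pos z
  have h9 := coeff_geom_le_one N three_pos (z - N)
  have h10 := coeff_geom_nonneg N four_pos (z - 1)
  have h11 := coeff_geom_le_one N four_pos z
  obtain ⟨x, rfl⟩ := Int.eq_ofNat_of_zero_le (show 0 ≤ z by omega)
  have h12 := coeff_geom_two_sq N x (by omega)
  have h13 := coeff_geom_two_sq N (x - 1) (by omega)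
  rw [show ((x - 1 : ℕ) : ℤ) = x - 1 by omega] at h13
  obtain ⟨s, hs⟩ : ∃ s : ℤ, s = 2 * N - 2 - x := ⟨_, rfl⟩
  have hs0 : 0 ≤ s := by omega
  have hsN : s ≤ N - 2 := by omega
  have hx : (x : ℤ) = 2 * N - 2 - s := by omega
  have hN' : (30 : ℤ) ≤ N := by exact_mod_cast hN
  have hquad : 2 * ((geom N 1 * (geom N 1 * geom N 1)).coeff (x : ℤ) -
      (geom N 1 * (geom N 1 * geom N 1)).coeff (x - N : ℤ)) =
        4 * (N * s) + 2 * N - 3 * (s * s) - 3 * s := by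
    rw [mul_sub, h6, h7, hx]
    ring
  have hsN' : 30 * s ≤ N * s := mul_le_mul_of_nonneg_right hN' hs0
  by_cases hpar : 2 ∣ x
  · rw [if_pos hpar] at h12
    rw [if_neg (by omega)] at h13
    rw [if_pos (by omega)]
    have : s * s ≤ N * s - 2 * s := by nlinarith
    omega
  · rw [if_neg hpar] at h12
    rw [if_pos (by omega)] at h13
    rw [if_neg (by omega)]
    rcases (show s = 1 ∨ 3 ≤ s by omega) with rfl | hs3
    · omega
    · have : 0 ≤ N * s - 2 * s - s * s - 3 * N + 6 + 3 * s := by nlinarith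
      omega

lemma middleCondition_two {N : ℕ} (hN : 30 ≤ N) : MiddleCondition N 2 := by
  intro z hz hz2
  push_cast at hz2 ⊢
  have h1 := diff_stairGen_two (z := z) (by omega) hz
  have h2 := diff_stairGen_two (N := N) (z := 4 * ((N : ℤ) - 1) + 1 - z) (by omega)
    (by omega)
  have h3 := diff_subsetGen_four hN hz (by omega)
  split_ifs at h1 h2 h3 <;> omega

lemma exists_middleCondition (b : ℕ) : ∃ N₀ : ℕ, ∀ N : ℕ, N₀ ≤ N → MiddleCondition N b :=
  match b with
  | 0 => ⟨0, fun N _ ↦ middleCondition_zero N⟩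
  | 1 => ⟨8, fun _ hN ↦ middleCondition_one hN⟩
  | 2 => ⟨30, fun _ hN ↦ middleCondition_two hN⟩
  | b + 3 => exists_middleCondition_add_three b

end

end TruncatedStaircase

/-- For every `b ≥ 1` there is `N` such that for all `n ≥ N` the sequence
`c_{n,b}(0), …, c_{n,b}(bn − b(b−1)/2)` is unimodal. -/
theorem truncated_staircase_unimodal (b : ℕ) (hb : 1 ≤ b) :
    ∃ N : ℕ, ∀ n : ℕ, N ≤ n →
      ∃ k : ℕ, k ≤ b * n - b * (b - 1) / 2 ∧
        (∀ i : ℕ, i < k → truncStaircaseCount n b i ≤ truncStaircaseCount n b (i + 1)) ∧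
        (∀ i : ℕ, k ≤ i → i < b * n - b * (b - 1) / 2 →
          truncStaircaseCount n b (i + 1) ≤ truncStaircaseCount n b i) := by
  obtain rfl | ⟨b, rfl⟩ : b = 1 ∨ ∃ c, b = c + 2 := by
    rcases b with _ | _ | b
    · omega
    · exact Or.inl rfl
    · exact Or.inr ⟨b, rfl⟩
  · refine ⟨1, fun n hn ↦ TruncatedStaircase.unimodal_of_diff hn (fun z hz hz2 ↦ ?_) fun z hz ↦ ?_⟩
    all_goals
      rw [TruncatedStaircase.coeff_stairGen_one, TruncatedStaircase.coeff_stairGen_one]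
      push_cast at *
      split_ifs <;> omega
  · obtain ⟨N₀, hN₀⟩ := TruncatedStaircase.exists_middleCondition b
    refine ⟨N₀ + b + 2, fun n hn ↦ TruncatedStaircase.unimodal_of_diff (by omega)
      (fun z hz hz2 ↦ ?_) fun z hz ↦ ?_⟩
    · exact TruncatedStaircase.coeff_stairGen_mono (by omega) (hN₀ (n + 1) (by omega)) hz
        (by simpa using hz2)
    · exact TruncatedStaircase.coeff_stairGen_anti (by omega) (hN₀ (n + 1) (by omega))
        (by simpa using hz)
end

section
/- Let A, B > 0 and let f, g : ℝ → ℝ be twice continuously differentiable, strictly positive functions such that (−log f)''(x) ≥ 1/A and (−log g)''(x) ≥ 1/B for all x ∈ ℝ. Then the convolution f∗g is strictly positive, twice differentiable, and satisfies (−log(f∗g))''(x) ≥ 1/(A+B) for all x ∈ ℝ. -/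
open MeasureTheory

/-- The convolution `(f ∗ g)(x) = ∫ f(t) g(x−t) dt`. -/
noncomputable def conv (f g : ℝ → ℝ) : ℝ → ℝ := fun x => ∫ t : ℝ, f t * g (x - t)

/-- A differentiable function with integrable continuous derivative is bounded. -/
lemma exists_bound_of_integrable_deriv {v : ℝ → ℝ} (hv : ContDiff ℝ 1 v)
    (hv' : Integrable (deriv v)) : ∃ M, ∀ x, |v x| ≤ M := by
  refine ⟨|v 0| + ∫ t, |deriv v t|, fun x => ?_⟩
  have hftc : ∫ t in (0 : ℝ)..x, deriv v t = v x - v 0 :=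
    intervalIntegral.integral_eq_sub_of_hasDerivAt
      (fun t _ => (hv.differentiable one_ne_zero t).hasDerivAt) hv'.intervalIntegrable
  have hle : |v x - v 0| ≤ ∫ t, |deriv v t| := by
    rw [← hftc]
    exact (intervalIntegral.norm_integral_le_integral_norm_uIoc (f := deriv v)).trans
      (setIntegral_le_integral hv'.norm (Filter.Eventually.of_forall fun t => abs_nonneg _))
  have htri : |v x| ≤ |v 0| + |v x - v 0| := by
    simpa using abs_add_le (v 0) (v x - v 0)
  linarith

lemma conv_comm (u v : ℝ → ℝ) : conv u v = conv v u := by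
  funext x
  have h := integral_sub_left_eq_self (fun t => u t * v (x - t)) volume x
  simp only [conv]
  rw [← h]
  simp [mul_comm]

lemma integrable_mul_comp_sub {u v : ℝ → ℝ} (hu : Integrable u) (hv : Continuous v)
    {M : ℝ} (hM : ∀ x, |v x| ≤ M) (x : ℝ) : Integrable fun t => u t * v (x - t) :=
  hu.mul_bdd (c := M) (by fun_prop) (Filter.Eventually.of_forall fun t => hM (x - t))

lemma hasDerivAt_conv {u v : ℝ → ℝ} (hu : Integrable u) (hv : ContDiff ℝ 1 v)
    {M M' : ℝ} (hM : ∀ x, |v x| ≤ M) (hM' : ∀ x, |deriv v x| ≤ M') (x : ℝ) :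
    HasDerivAt (conv u v) (conv u (deriv v) x) x := by
  have hv' : Continuous (deriv v) := hv.continuous_deriv le_rfl
  refine (hasDerivAt_integral_of_dominated_loc_of_deriv_le (μ := volume)
    (F := fun y t => u t * v (y - t)) (F' := fun y t => u t * deriv v (y - t))
    (bound := fun t => |u t| * M') (Filter.univ_mem (f := nhds x))
    (Filter.Eventually.of_forall fun y =>
      (integrable_mul_comp_sub hu hv.continuous hM y).aestronglyMeasurable)
    (integrable_mul_comp_sub hu hv.continuous hM x)
    (integrable_mul_comp_sub hu hv' hM' x).aestronglyMeasurable
    (Filter.Eventually.of_forall fun t y _ => ?_) (hu.abs.mul_const M')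
    (Filter.Eventually.of_forall fun t y _ => ?_)).2
  · rw [Real.norm_eq_abs, abs_mul]
    exact mul_le_mul_of_nonneg_left (hM' _) (abs_nonneg _)
  · have h := (hv.differentiable one_ne_zero (y - t)).hasDerivAt.comp y
      ((hasDerivAt_id y).sub_const t)
    simpa using h.const_mul (u t)

/-- The unnormalised covariance of `u` and `v` under the weight `w`, written as a symmetric
double integral. -/
lemma integral_prod_sub_mul_sub {w u v : ℝ → ℝ} (hw : Integrable w)
    (hu : Integrable fun t => u t * w t) (hv : Integrable fun t => v t * w t)
    (huv : Integrable fun t => u t * v t * w t) :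
    Integrable (fun z : ℝ × ℝ => (u z.1 - u z.2) * (v z.1 - v z.2) * (w z.1 * w z.2))
        (volume.prod volume) ∧
      ∫ z : ℝ × ℝ, (u z.1 - u z.2) * (v z.1 - v z.2) * (w z.1 * w z.2) ∂(volume.prod volume) =
        2 * ((∫ t, w t) * (∫ t, u t * v t * w t) - (∫ t, u t * w t) * ∫ t, v t * w t) := by
  have h₁ := huv.mul_prod hw
  have h₂ := hu.mul_prod hv
  have h₃ := hv.mul_prod hu
  have h₄ := hw.mul_prod huv
  have heq : (fun z : ℝ × ℝ => (u z.1 - u z.2) * (v z.1 - v z.2) * (w z.1 * w z.2)) =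
      fun z => (u z.1 * v z.1 * w z.1) * w z.2 - (u z.1 * w z.1) * (v z.2 * w z.2)
        - (v z.1 * w z.1) * (u z.2 * w z.2) + w z.1 * (u z.2 * v z.2 * w z.2) := by
    funext z; ring
  rw [heq]
  refine ⟨((h₁.sub h₂).sub h₃).add h₄, ?_⟩
  refine (integral_add ((h₁.sub h₂).sub h₃) h₄).trans ?_
  rw [integral_sub' (h₁.sub h₂) h₃, integral_sub' h₁ h₂,
    integral_prod_mul (fun t => u t * v t * w t) w, integral_prod_mul (fun t => u t * w t) (fun t => v t * w t),
    integral_prod_mul (fun t => v t * w t) (fun t => u t * w t),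
    integral_prod_mul w (fun t => u t * v t * w t)]
  ring

lemma deriv_neg_log {f : ℝ → ℝ} (hf : Differentiable ℝ f) (hfpos : ∀ x, 0 < f x) :
    deriv (fun y => -Real.log (f y)) = fun x => -(deriv f x / f x) := by
  funext x
  exact ((hf x).hasDerivAt.log (hfpos x).ne').neg.deriv

lemma sub_le_mul_sub_of_le_deriv_deriv_neg_log {A : ℝ} (hA : 0 < A) {f : ℝ → ℝ}
    (hf : ContDiff ℝ 2 f) (hfpos : ∀ x, 0 < f x)
    (hflc : ∀ x, 1 / A ≤ deriv (deriv (fun y => -Real.log (f y))) x) {s t : ℝ} (hst : s ≤ t) :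
    t - s ≤ A * (-(deriv f t / f t) - -(deriv f s / f s)) := by
  have hd : Differentiable ℝ fun x => -(deriv f x / f x) := by
    have h' : Differentiable ℝ (deriv f) :=
      (hf.deriv' (n := 1)).differentiable one_ne_zero
    exact (h'.div (hf.differentiable two_ne_zero) fun x => (hfpos x).ne').neg
  rw [deriv_neg_log (hf.differentiable two_ne_zero) hfpos] at hflc
  have h := mul_sub_le_image_sub_of_le_deriv hd hflc hst
  calc t - s = A * (1 / A * (t - s)) := by field_simp
    _ ≤ _ := mul_le_mul_of_nonneg_left h hA.le

lemma exists_bound_id_mul {A : ℝ} (hA : 0 < A) {f : ℝ → ℝ}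
    (hf : ContDiff ℝ 2 f) (hfpos : ∀ x, 0 < f x)
    (hflc : ∀ x, 1 / A ≤ deriv (deriv (fun y => -Real.log (f y))) x)
    {M M' : ℝ} (hM : ∀ x, |f x| ≤ M) (hM' : ∀ x, |deriv f x| ≤ M') :
    ∃ K, ∀ x, |x * f x| ≤ K := by
  set c := deriv f 0 / f 0
  refine ⟨A * (M' + |c| * M), fun x => ?_⟩
  have hx : |x| ≤ A * |c - deriv f x / f x| := by
    rcases le_total 0 x with h | h
    · have := sub_le_mul_sub_of_le_deriv_deriv_neg_log hA hf hfpos hflc h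
      rw [abs_of_nonneg h]
      have h' := mul_le_mul_of_nonneg_left (le_abs_self (c - deriv f x / f x)) hA.le
      linarith
    · have := sub_le_mul_sub_of_le_deriv_deriv_neg_log hA hf hfpos hflc h
      rw [abs_of_nonpos h]
      have h' := mul_le_mul_of_nonneg_left (neg_abs_le (c - deriv f x / f x)) hA.le
      linarith
  have hfx := hfpos x
  calc |x * f x| = |x| * f x := by rw [abs_mul, abs_of_pos hfx]
    _ ≤ A * |c - deriv f x / f x| * f x := mul_le_mul_of_nonneg_right hx hfx.le
    _ = A * |c * f x - deriv f x| := by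
        rw [mul_assoc, ← abs_of_pos hfx, ← abs_mul, abs_of_pos hfx, sub_mul,
          div_mul_cancel₀ _ hfx.ne']
    _ ≤ A * (M' + |c| * M) := by
        refine mul_le_mul_of_nonneg_left ?_ hA.le
        have h₁ := abs_sub (c * f x) (deriv f x)
        rw [abs_mul] at h₁
        have h₂ := mul_le_mul_of_nonneg_left (hM x) (abs_nonneg c)
        linarith [hM' x]

lemma deriv_deriv_neg_log {h h' : ℝ → ℝ} {h'' x : ℝ} (hpos : ∀ y, 0 < h y)
    (hh : ∀ y, HasDerivAt h (h' y) y) (hh' : HasDerivAt h' h'' x) :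
    deriv (deriv fun y => -Real.log (h y)) x = (h' x * h' x - h x * h'') / h x ^ 2 := by
  rw [deriv_neg_log (fun y => (hh y).differentiableAt) hpos, funext fun y => (hh y).deriv]
  refine ((hh'.div (hh x) (hpos x).ne').neg.deriv).trans ?_
  ring

lemma add_mul_sub_le_mul {A B a b d : ℝ} (hA : 0 < A) (hB : 0 < B) (hd : 0 ≤ d)
    (ha : d ≤ A * a) (hb : d ≤ B * b) : d * (a + b) ≤ (A + B) * (a * b) := by
  have ha' : 0 ≤ a := nonneg_of_mul_nonneg_right (hd.trans ha) hA
  have hb' : 0 ≤ b := nonneg_of_mul_nonneg_right (hd.trans hb) hB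
  nlinarith [mul_le_mul_of_nonneg_right ha hb', mul_le_mul_of_nonneg_right hb ha']

/-- If `f, g > 0` are `C²`, integrable together with their first and second derivatives,
and satisfy `(−log f)'' ≥ 1/A` and `(−log g)'' ≥ 1/B`, then `f ∗ g` is strictly positive,
twice differentiable, and satisfies `(−log (f ∗ g))'' ≥ 1/(A+B)`. -/
theorem log_concavity_convolution (A B : ℝ) (hA : 0 < A) (hB : 0 < B)
    (f g : ℝ → ℝ) (hf : ContDiff ℝ 2 f) (hg : ContDiff ℝ 2 g)
    (hfpos : ∀ x, 0 < f x) (hgpos : ∀ x, 0 < g x)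
    (hfint : Integrable f) (hfint' : Integrable (deriv f))
    (hfint'' : Integrable (deriv (deriv f)))
    (hgint : Integrable g) (hgint' : Integrable (deriv g))
    (hgint'' : Integrable (deriv (deriv g)))
    (hflc : ∀ x, 1 / A ≤ deriv (deriv (fun y => -Real.log (f y))) x)
    (hglc : ∀ x, 1 / B ≤ deriv (deriv (fun y => -Real.log (g y))) x) :
    (∀ x, 0 < conv f g x) ∧
    (∀ x, DifferentiableAt ℝ (conv f g) x) ∧
    (∀ x, DifferentiableAt ℝ (deriv (conv f g)) x) ∧
    (∀ x, 1 / (A + B) ≤ deriv (deriv (fun y => -Real.log (conv f g y))) x) := by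
  have hf1 : ContDiff ℝ 1 f := hf.of_le one_le_two
  have hg1 : ContDiff ℝ 1 g := hg.of_le one_le_two
  have hdf1 : ContDiff ℝ 1 (deriv f) := hf.deriv' (n := 1)
  have hdg1 : ContDiff ℝ 1 (deriv g) := hg.deriv' (n := 1)
  obtain ⟨Mf, hMf⟩ := exists_bound_of_integrable_deriv hf1 hfint'
  obtain ⟨Mg, hMg⟩ := exists_bound_of_integrable_deriv hg1 hgint'
  obtain ⟨Mf', hMf'⟩ := exists_bound_of_integrable_deriv hdf1 hfint''
  obtain ⟨Mg', hMg'⟩ := exists_bound_of_integrable_deriv hdg1 hgint''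
  have hpos : ∀ x, 0 < conv f g x := fun x => by
    have hp : ∀ t, 0 < f t * g (x - t) := fun t => mul_pos (hfpos _) (hgpos _)
    refine (integral_pos_iff_support_of_nonneg (fun t => (hp t).le)
      (integrable_mul_comp_sub hfint hg.continuous hMg x)).2 ?_
    rw [Function.support_eq_univ fun t => (hp t).ne']
    simp
  have hd : ∀ x, HasDerivAt (conv f g) (conv f (deriv g) x) x :=
    hasDerivAt_conv hfint hg1 hMg hMg'
  have hswap : ∀ x, conv (deriv f) g x = conv f (deriv g) x := fun x => by
    have h := hasDerivAt_conv hgint hf1 hMf hMf' x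
    rw [conv_comm g f, conv_comm g (deriv f)] at h
    exact h.unique (hd x)
  have hd' : ∀ x, HasDerivAt (conv f (deriv g)) (conv (deriv f) (deriv g) x) x := fun x => by
    rw [conv_comm f, conv_comm (deriv f)]
    exact hasDerivAt_conv hgint' hf1 hMf hMf' x
  refine ⟨hpos, fun x => (hd x).differentiableAt, fun x => ?_, fun x => ?_⟩
  · rw [funext fun y => (hd y).deriv]
    exact (hd' x).differentiableAt
  rw [deriv_deriv_neg_log hpos hd (hd' x),
    div_le_div_iff₀ (add_pos hA hB) (pow_pos (hpos x) 2), one_mul]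
  obtain ⟨Kf, hKf⟩ := exists_bound_id_mul hA hf hfpos hflc hMf hMf'
  obtain ⟨Kg, hKg⟩ := exists_bound_id_mul hB hg hgpos hglc hMg hMg'
  have hcf := hf.continuous
  have hcg := hg.continuous
  have hcf' := hdf1.continuous
  have hcg' := hdg1.continuous
  have ifg := integrable_mul_comp_sub hfint hcg hMg x
  have idfg := integrable_mul_comp_sub hfint' hcg hMg x
  have ifdg := integrable_mul_comp_sub hfint hcg' hMg' x
  have idfdg := integrable_mul_comp_sub hfint' hcg' hMg' x
  have itfg : Integrable fun t => t * (f t * g (x - t)) :=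
    ((hgint.comp_sub_left x).bdd_mul (c := Kf) (f := fun t => t * f t) (by fun_prop)
      (Filter.Eventually.of_forall hKf)).congr (Filter.Eventually.of_forall fun t => by ring)
  have itfdg : Integrable fun t => t * (f t * deriv g (x - t)) :=
    ((hgint'.comp_sub_left x).bdd_mul (c := Kf) (f := fun t => t * f t) (by fun_prop)
      (Filter.Eventually.of_forall hKf)).congr (Filter.Eventually.of_forall fun t => by ring)
  have itdfg : Integrable fun t => t * (deriv f t * g (x - t)) :=
    ((idfg.const_mul x).sub (integrable_mul_comp_sub (v := fun y => y * g y) hfint'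
      (by fun_prop) hKg x)).congr (Filter.Eventually.of_forall fun t => by
        simp only [Pi.sub_apply]; ring)
  have hibp : ∫ t, t * (deriv f t * g (x - t) - f t * deriv g (x - t)) = -conv f g x := by
    have h := integral_mul_deriv_eq_deriv_mul_of_integrable (u := fun t : ℝ => t)
      (u' := fun _ => 1) (v := fun t => f t * g (x - t))
      (v' := fun t => deriv f t * g (x - t) - f t * deriv g (x - t))
      (fun t _ => hasDerivAt_id t)
      (fun t _ => by
        have hg₁ := (hg1.differentiable one_ne_zero (x - t)).hasDerivAt.comp t
          ((hasDerivAt_id t).const_sub x)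
        refine ((hf1.differentiable one_ne_zero t).hasDerivAt.mul hg₁).congr_deriv ?_
        simp only [Function.comp_apply]
        ring)
      ((itdfg.sub itfdg).congr (Filter.Eventually.of_forall fun t => by
        simp only [Pi.sub_apply, Pi.mul_apply]; ring))
      (ifg.congr (Filter.Eventually.of_forall fun t => by
        simp only [Pi.mul_apply]; ring))
      itfg
    simpa [conv] using h
  set w : ℝ → ℝ := fun t => f t * g (x - t) with hw
  set φ : ℝ → ℝ := fun t => -(deriv f t / f t) with hφ
  set ψ : ℝ → ℝ := fun t => -(deriv g (x - t) / g (x - t)) with hψ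
  have hφw : ∀ t, φ t * w t = -(deriv f t * g (x - t)) := fun t => by
    have := (hfpos t).ne'
    simp only [hφ, hw]; field_simp
  have hψw : ∀ t, ψ t * w t = -(f t * deriv g (x - t)) := fun t => by
    have := (hgpos (x - t)).ne'
    simp only [hψ, hw]; field_simp
  have hφψw : ∀ t, φ t * ψ t * w t = deriv f t * deriv g (x - t) := fun t => by
    have := (hfpos t).ne'
    have := (hgpos (x - t)).ne'
    simp only [hφ, hψ, hw]; field_simp
  have hVw : ∀ t, (φ t - ψ t) * w t = f t * deriv g (x - t) - deriv f t * g (x - t) :=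
    fun t => by rw [sub_mul, hφw, hψw]; ring
  have htVw : ∀ t, t * (φ t - ψ t) * w t =
      -(t * (deriv f t * g (x - t) - f t * deriv g (x - t))) :=
    fun t => by rw [mul_assoc, hVw]; ring
  obtain ⟨hi₁, he₁⟩ := integral_prod_sub_mul_sub (w := w) (u := φ) (v := ψ) ifg
    (by simp only [hφw]; exact idfg.neg) (by simp only [hψw]; exact ifdg.neg)
    (by simp only [hφψw]; exact idfdg)
  obtain ⟨hi₂, he₂⟩ := integral_prod_sub_mul_sub (w := w) (u := fun t => t)
    (v := fun t => φ t - ψ t) ifg itfg (by simp only [hVw]; exact ifdg.sub idfg)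
    (by
      simp only [htVw]
      exact ((itdfg.sub itfdg).congr (Filter.Eventually.of_forall fun t => by
        simp only [Pi.sub_apply]; ring)).neg)
  simp only [hφw, hψw, hφψw, integral_neg] at he₁
  simp only [hVw, htVw, integral_neg, hibp] at he₂
  rw [integral_sub ifdg idfg] at he₂
  have hs := hswap x
  have hmono := integral_mono hi₂ (hi₁.const_mul (-(A + B))) fun z => by
    have hwz : 0 ≤ w z.1 * w z.2 :=
      mul_nonneg (mul_pos (hfpos _) (hgpos _)).le (mul_pos (hfpos _) (hgpos _)).le
    have hφ_le : ∀ {s t}, s ≤ t → t - s ≤ A * (φ t - φ s) := fun hst =>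
      sub_le_mul_sub_of_le_deriv_deriv_neg_log hA hf hfpos hflc hst
    have hψ_le : ∀ {s t}, s ≤ t → t - s ≤ B * (ψ s - ψ t) := fun {s t} hst => by
      have := sub_le_mul_sub_of_le_deriv_deriv_neg_log hB hg hgpos hglc
        (sub_le_sub_left hst x)
      rwa [sub_sub_sub_cancel_left] at this
    have key : (z.1 - z.2) * ((φ z.1 - ψ z.1) - (φ z.2 - ψ z.2)) ≤
        -(A + B) * ((φ z.1 - φ z.2) * (ψ z.1 - ψ z.2)) := by
      rcases le_total z.2 z.1 with h | h
      · linarith [add_mul_sub_le_mul hA hB (sub_nonneg.2 h) (hφ_le h) (hψ_le h)]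
      · linarith [add_mul_sub_le_mul hA hB (sub_nonneg.2 h) (hφ_le h) (hψ_le h)]
    have := mul_le_mul_of_nonneg_right key hwz
    simpa only [mul_assoc] using this
  rw [integral_const_mul, he₁, he₂] at hmono
  simp only [conv] at hs hmono ⊢
  rw [hs] at hmono
  simp only [hw] at hmono
  linarith
end

section
/- For every integer b ≥ 5 there exists N such that for all n ≥ N and all integers ℓ with (1728/1729)·n ≤ ℓ ≤ (b − 1728/1729)·n, the count c_{n,b}(ℓ) is logarithmically concave at ℓ: c_{n,b}(ℓ)² ≥ c_{n,b}(ℓ−1) · c_{n,b}(ℓ+1). -/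
/-- The number of `b`-tuples of elements of `{1, …, n}` with sum `ℓ`, as a real number. -/
noncomputable def tupleCount (n : ℕ) : ℕ → ℤ → ℝ
  | 0, ℓ => if ℓ = 0 then 1 else 0
  | b + 1, ℓ => ∑ j ∈ Finset.range n, tupleCount n b (ℓ - (j + 1))

/-- Log-concavity of a sequence indexed by `ℤ`, in the form that excludes internal zeros. -/
def StrongLogConcave (h : ℤ → ℝ) : Prop :=
  ∀ a b c d : ℤ, a ≤ b → a ≤ c → a + d = b + c → h a * h d ≤ h b * h c

theorem tupleCount_nonneg (n b : ℕ) (ℓ : ℤ) : 0 ≤ tupleCount n b ℓ := by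
  induction b generalizing ℓ with
  | zero => simp only [tupleCount]; split_ifs <;> norm_num
  | succ b ih => exact Finset.sum_nonneg fun j _ => ih _

theorem tupleCount_of_neg (n b : ℕ) {ℓ : ℤ} (hℓ : ℓ < 0) : tupleCount n b ℓ = 0 := by
  induction b generalizing ℓ with
  | zero => simp only [tupleCount]; rw [if_neg hℓ.ne]
  | succ b ih => exact Finset.sum_eq_zero fun j _ => ih (by omega)

theorem tupleCount_reflect (n b : ℕ) (ℓ : ℤ) :
    tupleCount n b (b * (n + 1) - ℓ) = tupleCount n b ℓ := by
  induction b generalizing ℓ with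
  | zero => simp [tupleCount]
  | succ b ih =>
    simp only [tupleCount]
    rw [← Finset.sum_range_reflect]
    refine Finset.sum_congr rfl fun j hj => ?_
    rw [← ih]
    congr 1
    have := Finset.mem_range.1 hj
    rw [Nat.sub_sub, Nat.cast_sub (by omega)]
    push_cast
    ring

theorem tupleCount_one (n : ℕ) (ℓ : ℤ) :
    tupleCount n 1 ℓ = if 1 ≤ ℓ ∧ ℓ ≤ n then 1 else 0 := by
  simp only [tupleCount]
  split_ifs with h
  · rw [Finset.sum_eq_single_of_mem (ℓ - 1).toNat (by simp; omega)]
    · rw [if_pos (by omega)]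
    · intro j _ hj
      rw [if_neg (by omega)]
  · refine Finset.sum_eq_zero fun j hj => ?_
    have := Finset.mem_range.1 hj
    rw [if_neg (by omega)]

theorem tupleCount_succ_le (n b : ℕ) (ℓ : ℤ) : tupleCount n (b + 1) ℓ ≤ (n : ℝ) ^ b := by
  induction b generalizing ℓ with
  | zero => rw [tupleCount_one]; split_ifs <;> norm_num
  | succ b ih =>
    rw [tupleCount]
    calc _ ≤ ∑ j ∈ Finset.range n, (n : ℝ) ^ b := Finset.sum_le_sum fun j _ => ih _
      _ = (n : ℝ) ^ (b + 1) := by simp [pow_succ, mul_comm]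

theorem tupleCount_succ_sub (n b : ℕ) (x : ℤ) :
    tupleCount n (b + 1) (x + 1) - tupleCount n (b + 1) x =
      tupleCount n b x - tupleCount n b (x - n) := by
  simp only [tupleCount]
  rw [← Finset.sum_sub_distrib]
  have := Finset.sum_range_sub' (fun j : ℕ => tupleCount n b (x - j)) n
  simp only [Nat.cast_zero, sub_zero] at this
  rw [← this]
  refine Finset.sum_congr rfl fun j _ => ?_
  push_cast
  rw [add_sub_add_right_eq_sub]

theorem tupleCount_succ_det (n b : ℕ) (x y : ℤ) :
    tupleCount n (b + 1) (x + 1) * tupleCount n (b + 1) y -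
        tupleCount n (b + 1) x * tupleCount n (b + 1) (y + 1) =
      ∑ j ∈ Finset.range n,
        ((tupleCount n b x * tupleCount n b (y - (j + 1)) -
            tupleCount n b y * tupleCount n b (x - (j + 1))) +
          (tupleCount n b (y - n) * tupleCount n b (x - (j + 1)) -
            tupleCount n b (x - n) * tupleCount n b (y - (j + 1)))) := by
  have hx := tupleCount_succ_sub n b x
  have hy := tupleCount_succ_sub n b y
  have ex : tupleCount n (b + 1) x = ∑ j ∈ Finset.range n, tupleCount n b (x - (j + 1)) := rfl
  have ey : tupleCount n (b + 1) y = ∑ j ∈ Finset.range n, tupleCount n b (y - (j + 1)) := rfl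
  simp only [Finset.sum_add_distrib, Finset.sum_sub_distrib, ← Finset.mul_sum]
  rw [← ex, ← ey]
  linear_combination tupleCount n (b + 1) y * hx - tupleCount n (b + 1) x * hy

theorem strongLogConcave_of_step {h : ℤ → ℝ}
    (hstep : ∀ x y : ℤ, x ≤ y → h x * h (y + 1) ≤ h (x + 1) * h y) : StrongLogConcave h := by
  have key : ∀ (s : ℕ) (a d : ℤ), a + 2 * s ≤ d → h a * h d ≤ h (a + s) * h (d - s) := by
    intro s
    induction s with
    | zero => simp
    | succ s ih =>
      intro a d had
      push_cast at had ⊢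
      refine (ih a d (by omega)).trans ?_
      have := hstep (a + s) (d - s - 1) (by omega)
      rw [sub_add_cancel] at this
      rwa [← add_assoc, ← sub_sub]
  intro a b c d hab hac had
  rcases le_total b c with hbc | hbc
  · have := key (b - a).toNat a d (by omega)
    rw [Int.toNat_of_nonneg (by omega)] at this
    rwa [show a + (b - a) = b by ring, show d - (b - a) = c by omega] at this
  · have := key (c - a).toNat a d (by omega)
    rw [Int.toNat_of_nonneg (by omega)] at this
    rwa [show a + (c - a) = c by ring, show d - (c - a) = b by omega, mul_comm (h c)] at this

theorem strongLogConcave_tupleCount (n b : ℕ) : StrongLogConcave (tupleCount n b) := by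
  induction b with
  | zero =>
    intro a b c d hab hac had
    have hn : 0 ≤ tupleCount n 0 b * tupleCount n 0 c :=
      mul_nonneg (tupleCount_nonneg _ _ _) (tupleCount_nonneg _ _ _)
    by_cases ha : a = 0
    · by_cases hd : d = 0
      · rw [show b = 0 by omega, show c = 0 by omega, ha, hd]
      · rwa [tupleCount, tupleCount, if_neg hd, mul_zero]
    · rwa [tupleCount, tupleCount, if_neg ha, zero_mul]
  | succ b ih =>
    refine strongLogConcave_of_step fun x y hxy => ?_
    rw [← sub_nonneg, tupleCount_succ_det]
    refine Finset.sum_nonneg fun j hj => ?_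
    have hj := Finset.mem_range.1 hj
    have h1 := ih (x - (j + 1)) x (y - (j + 1)) y (by omega) (by omega) (by ring)
    have h2 := ih (x - n) (y - n) (x - (j + 1)) (y - (j + 1)) (by omega) (by omega) (by ring)
    linarith

/-- The ratios `h i / h (i - 1)` decrease at least linearly where the log-concavity defect of `h`
is bounded below. -/
theorem ratio_gap {h : ℤ → ℝ} {lo up δ : ℝ} {k : ℤ} {s : ℕ} (hlo : 0 < lo) (hδ : 0 ≤ δ)
    (hl : ∀ i, k - s - 1 ≤ i → i < k → lo ≤ h i)
    (hu : ∀ i, h i ≤ up)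
    (hd : ∀ i, k - s ≤ i → i < k → δ ≤ h i ^ 2 - h (i - 1) * h (i + 1)) :
    s * (δ / up ^ 2) * lo ^ 2 ≤ h (k - 1) * h (k - s) - h k * h (k - s - 1) := by
  have hup : 0 < up := hlo.trans_le ((hl (k - s - 1) le_rfl (by omega)).trans (hu _))
  have ratio : ∀ t : ℕ, t ≤ s → t * (δ / up ^ 2) ≤ h (k - t) / h (k - t - 1) - h k / h (k - 1) := by
    intro t
    induction t with
    | zero => simp
    | succ t ih =>
      intro ht
      have h0 := hl (k - t - 1) (by omega) (by omega)
      have h1 := hl (k - t - 1 - 1) (by omega) (by omega)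
      have hD := hd (k - t - 1) (by omega) (by omega)
      have hp0 := hlo.trans_le h0
      have hp1 := hlo.trans_le h1
      have step : δ / up ^ 2 ≤ h (k - t - 1) / h (k - t - 1 - 1) - h (k - t) / h (k - t - 1) := by
        rw [div_sub_div _ _ hp1.ne' hp0.ne']
        rw [sub_add_cancel] at hD
        refine div_le_div₀ (hδ.trans (by linarith)) (by linarith) (by positivity) ?_
        nlinarith [hu (k - t - 1), hu (k - t - 1 - 1)]
      have := ih (by omega)
      push_cast
      rw [← sub_sub]
      linarith
  have hr := ratio s le_rfl
  have h0 := hl (k - s - 1) le_rfl (by omega)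
  have h1 := hl (k - 1) (by omega) (by omega)
  have hp0 := hlo.trans_le h0
  have hp1 := hlo.trans_le h1
  have hr0 : 0 ≤ s * (δ / up ^ 2) := by positivity
  rw [div_sub_div _ _ hp0.ne' hp1.ne', le_div_iff₀ (by positivity)] at hr
  have : s * (δ / up ^ 2) * lo ^ 2 ≤ s * (δ / up ^ 2) * (h (k - s - 1) * h (k - 1)) := by
    gcongr
    nlinarith
  linarith

theorem tupleCount_two (n : ℕ) {ℓ : ℤ} (h1 : 1 ≤ ℓ) (h2 : ℓ ≤ 2 * n + 1) :
    tupleCount n 2 ℓ = min ((ℓ : ℝ) - 1) (2 * n + 1 - ℓ) := by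
  have h := fun x => tupleCount_succ_sub n 1 x
  simp only [tupleCount_one] at h
  have up : ∀ k : ℕ, (k : ℤ) ≤ n → tupleCount n 2 (k + 1) = k := by
    intro k
    induction k with
    | zero =>
      intro _
      rw [Nat.cast_zero (R := ℝ), tupleCount]
      refine Finset.sum_eq_zero (s := Finset.range n) fun j _ => ?_
      rw [tupleCount_one, if_neg (by omega)]
    | succ k ih =>
      intro hk
      have := h (k + 1)
      rw [if_pos (by omega), if_neg (by omega), ih (by omega)] at this
      push_cast at this ⊢
      linarith
  rcases le_total ℓ (n + 1) with hn | hn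
  · have := up (ℓ - 1).toNat (by omega)
    have e : ((ℓ - 1).toNat : ℤ) = ℓ - 1 := Int.toNat_of_nonneg (by omega)
    rw [← Int.cast_natCast (R := ℝ), e] at this
    have hn' : (ℓ : ℝ) ≤ n + 1 := by exact_mod_cast hn
    rw [min_eq_left (by linarith)]
    simpa using this
  · have := up (2 * n + 1 - ℓ).toNat (by omega)
    have e : ((2 * n + 1 - ℓ).toNat : ℤ) = 2 * n + 1 - ℓ := Int.toNat_of_nonneg (by omega)
    rw [← Int.cast_natCast (R := ℝ), e] at this
    have hn' : (n + 1 : ℝ) ≤ ℓ := by exact_mod_cast hn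
    rw [min_eq_right (by linarith), ← tupleCount_reflect]
    rw [show ((2 : ℕ) : ℤ) * (n + 1) - ℓ = 2 * n + 1 - ℓ + 1 by push_cast; ring, this]
    push_cast
    ring

/-- In the bulk, the number of `(β + 2)`-tuples has the expected order of magnitude, and so does
its log-concavity defect. -/
theorem tupleCount_bulk (β : ℕ) : ∀ ε : ℝ, 0 < ε → ε ≤ 1 / 2 → ∃ c : ℝ, 0 < c ∧ ∃ N : ℕ,
    ∀ n : ℕ, N ≤ n → ∀ ℓ : ℤ, ε * n ≤ ℓ → (ℓ : ℝ) ≤ (β + 2) * (n + 1) - ε * n →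
      c * (n : ℝ) ^ (β + 1) ≤ tupleCount n (β + 2) ℓ ∧
      c * (n : ℝ) ^ (2 * β) ≤ tupleCount n (β + 2) ℓ ^ 2 -
        tupleCount n (β + 2) (ℓ - 1) * tupleCount n (β + 2) (ℓ + 1) := by
  induction β with
  | zero =>
    intro ε hε hε2
    obtain ⟨N, hN⟩ := exists_nat_gt (2 / ε)
    refine ⟨ε / 2, by positivity, N, fun n hn ℓ h1 h2 => ?_⟩
    have hn' : 2 / ε < n := hN.trans_le (by exact_mod_cast hn)
    rw [div_lt_iff₀ hε] at hn'
    have a1 : 1 < ℓ := by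
      have : (1 : ℝ) < ℓ := by linarith
      exact_mod_cast this
    have a2 : ℓ < 2 * n + 1 := by
      have : (ℓ : ℝ) < 2 * n + 1 := by
        push_cast at h2
        linarith
      exact_mod_cast this
    rw [zero_add, tupleCount_two n (by omega) (by omega),
      tupleCount_two n (by omega : 1 ≤ ℓ - 1) (by omega), tupleCount_two n (by omega) (by omega)]
    push_cast at h2 ⊢
    constructor
    · rw [pow_one]
      refine le_min ?_ ?_ <;> linarith
    · rw [pow_zero, mul_one]
      rcases lt_trichotomy ℓ (n + 1) with h | h | h
      · have h' : (ℓ : ℝ) + 1 ≤ n + 1 := by exact_mod_cast h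
        rw [min_eq_left (by linarith), min_eq_left (by linarith), min_eq_left (by linarith)]
        nlinarith
      · have h' : (ℓ : ℝ) = n + 1 := by exact_mod_cast h
        rw [min_eq_left (by linarith), min_eq_left (by linarith), min_eq_right (by linarith), h']
        nlinarith
      · have h' : (n : ℝ) + 1 + 1 ≤ ℓ := by exact_mod_cast h
        rw [min_eq_right (by linarith), min_eq_right (by linarith), min_eq_right (by linarith)]
        nlinarith
  | succ β ih =>
    intro ε hε hε2
    obtain ⟨c, hc, N, hN⟩ := ih (ε / 2) (by positivity) (by linarith)
    obtain ⟨N', hN'⟩ := exists_nat_gt (8 / ε)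
    refine ⟨min (ε / 8 * c) (ε ^ 2 / 128 * c ^ 3), by positivity, max N N', ?_⟩
    intro n hn
    have hn1 : N ≤ n := (le_max_left _ _).trans hn
    have hn2 : 8 / ε < n := hN'.trans_le (by exact_mod_cast (le_max_right _ _).trans hn)
    rw [div_lt_iff₀ hε] at hn2
    have hn0 : (0 : ℝ) < n := by
      rcases Nat.eq_zero_or_pos n with h | h
      · rw [h] at hn2
        norm_num at hn2
      · exact_mod_cast h
    -- by symmetry it suffices to treat the lower half of the range
    suffices half : ∀ ℓ : ℤ, ε * n ≤ ℓ → (ℓ : ℝ) ≤ (β + 3) * (n + 1) / 2 →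
        ε / 8 * c * (n : ℝ) ^ (β + 2) ≤ tupleCount n (β + 3) ℓ ∧
        ε ^ 2 / 128 * c ^ 3 * (n : ℝ) ^ (2 * β + 2) ≤ tupleCount n (β + 3) ℓ ^ 2 -
          tupleCount n (β + 3) (ℓ - 1) * tupleCount n (β + 3) (ℓ + 1) by
      intro ℓ h1 h2
      have hmin : min (ε / 8 * c) (ε ^ 2 / 128 * c ^ 3) * (n : ℝ) ^ (β + 2) ≤
            ε / 8 * c * (n : ℝ) ^ (β + 2) ∧
          min (ε / 8 * c) (ε ^ 2 / 128 * c ^ 3) * (n : ℝ) ^ (2 * β + 2) ≤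
            ε ^ 2 / 128 * c ^ 3 * (n : ℝ) ^ (2 * β + 2) := by
        constructor
        · gcongr
          exact min_le_left _ _
        · gcongr
          exact min_le_right _ _
      rw [show β + 1 + 1 = β + 2 by ring, show β + 1 + 2 = β + 3 by ring,
        show 2 * (β + 1) = 2 * β + 2 by ring]
      push_cast at h2
      rcases le_total (ℓ : ℝ) ((β + 3) * (n + 1) / 2) with h | h
      · obtain ⟨i1, i2⟩ := half ℓ h1 h
        exact ⟨hmin.1.trans i1, hmin.2.trans i2⟩
      · obtain ⟨i1, i2⟩ := half (((β + 3 : ℕ) : ℤ) * (n + 1) - ℓ)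
          (by push_cast; linarith) (by push_cast; linarith)
        rw [sub_sub, sub_add, tupleCount_reflect, tupleCount_reflect, tupleCount_reflect,
          mul_comm (tupleCount _ _ (ℓ + 1))] at i2
        rw [tupleCount_reflect] at i1
        exact ⟨hmin.1.trans i1, hmin.2.trans i2⟩
    intro ℓ h1 h2
    obtain ⟨m, hm1, hm2⟩ : ∃ m : ℕ, ε / 8 * n ≤ m ∧ (m : ℝ) ≤ ε / 4 * n := by
      refine ⟨⌊ε / 4 * n⌋₊, ?_, Nat.floor_le (by positivity)⟩
      have := Nat.lt_floor_add_one (ε / 4 * n)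
      linarith
    have hmn : m ≤ n := by
      have : (m : ℝ) ≤ n := hm2.trans (by nlinarith)
      exact_mod_cast this
    have hβn : 0 ≤ (β : ℝ) * (n + 1) := by positivity
    have bulk : ∀ i : ℤ, ℓ - m - 1 ≤ i → i < ℓ →
        c * (n : ℝ) ^ (β + 1) ≤ tupleCount n (β + 2) i ∧
        c * (n : ℝ) ^ (2 * β) ≤ tupleCount n (β + 2) i ^ 2 -
          tupleCount n (β + 2) (i - 1) * tupleCount n (β + 2) (i + 1) := by
      intro i hi1 hi2
      have hi1' : (ℓ : ℝ) - m - 1 ≤ i := by exact_mod_cast hi1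
      have hi2' : (i : ℝ) + 1 ≤ ℓ := by exact_mod_cast hi2
      exact hN n hn1 i (by linarith) (by nlinarith)
    have hsub : Finset.range m ⊆ Finset.range n := Finset.range_subset_range.2 hmn
    constructor
    · calc ε / 8 * c * (n : ℝ) ^ (β + 2) = ε / 8 * n * (c * (n : ℝ) ^ (β + 1)) := by ring
        _ ≤ m * (c * (n : ℝ) ^ (β + 1)) := by gcongr
        _ = ∑ j ∈ Finset.range m, c * (n : ℝ) ^ (β + 1) := by simp
        _ ≤ ∑ j ∈ Finset.range m, tupleCount n (β + 2) (ℓ - (j + 1)) :=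
          Finset.sum_le_sum fun j hj =>
            (bulk _ (by have := Finset.mem_range.1 hj; omega) (by omega)).1
        _ ≤ tupleCount n (β + 3) ℓ :=
          Finset.sum_le_sum_of_subset_of_nonneg hsub fun _ _ _ => tupleCount_nonneg _ _ _
    · have hdet := tupleCount_succ_det n (β + 2) (ℓ - 1) ℓ
      rw [sub_add_cancel, ← pow_two] at hdet
      rw [show β + 3 = β + 2 + 1 by ring, hdet]
      have hlc := strongLogConcave_tupleCount n (β + 2)
      set h := tupleCount n (β + 2) with hh
      have hgap : ∀ j ∈ Finset.range m, (j + 1 : ℝ) * (c ^ 3 * (n : ℝ) ^ (2 * β)) ≤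
          h (ℓ - 1) * h (ℓ - (j + 1)) - h ℓ * h (ℓ - 1 - (j + 1)) := by
        intro j hj
        have hj := Finset.mem_range.1 hj
        have := ratio_gap (h := h) (lo := c * (n : ℝ) ^ (β + 1)) (up := (n : ℝ) ^ (β + 1))
          (δ := c * (n : ℝ) ^ (2 * β)) (k := ℓ) (s := j + 1) (by positivity) (by positivity)
          (fun i hi1 hi2 => (bulk i (by push_cast at hi1; omega) hi2).1)
          (fun i => tupleCount_succ_le n (β + 1) i)
          (fun i hi1 hi2 => (bulk i (by push_cast at hi1; omega) hi2).2)
        push_cast at this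
        rw [sub_right_comm ℓ 1]
        refine le_trans (le_of_eq ?_) this
        field_simp
      calc ε ^ 2 / 128 * c ^ 3 * (n : ℝ) ^ (2 * β + 2)
          = (ε / 8 * n) ^ 2 / 2 * (c ^ 3 * (n : ℝ) ^ (2 * β)) := by ring
        _ ≤ (m : ℝ) ^ 2 / 2 * (c ^ 3 * (n : ℝ) ^ (2 * β)) := by gcongr
        _ ≤ (∑ j ∈ Finset.range m, (j + 1 : ℝ)) * (c ^ 3 * (n : ℝ) ^ (2 * β)) := by
          gcongr
          clear_value h
          clear * -
          induction m with
          | zero => simp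
          | succ m ih =>
            rw [Finset.sum_range_succ]
            push_cast
            nlinarith
        _ = ∑ j ∈ Finset.range m, (j + 1 : ℝ) * (c ^ 3 * (n : ℝ) ^ (2 * β)) := Finset.sum_mul ..
        _ ≤ ∑ j ∈ Finset.range m,
            (h (ℓ - 1) * h (ℓ - (j + 1)) - h ℓ * h (ℓ - 1 - (j + 1))) := Finset.sum_le_sum hgap
        _ ≤ ∑ j ∈ Finset.range n,
            (h (ℓ - 1) * h (ℓ - (j + 1)) - h ℓ * h (ℓ - 1 - (j + 1))) := by
          refine Finset.sum_le_sum_of_subset_of_nonneg hsub fun j _ _ => ?_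
          have := hlc (ℓ - 1 - (j + 1)) (ℓ - 1) (ℓ - (j + 1)) ℓ (by omega) (by omega) (by ring)
          linarith
        _ ≤ _ := by
          refine Finset.sum_le_sum fun j hj => ?_
          have hj := Finset.mem_range.1 hj
          have := hlc (ℓ - 1 - n) (ℓ - n) (ℓ - 1 - (j + 1)) (ℓ - (j + 1)) (by omega) (by omega)
            (by ring)
          linarith

section GeneratingFunctions

open Polynomial

/-- The `k`-th power sums of `X, X ^ 2, …, X ^ n`, as a family in `n`. -/
noncomputable def psumFamily (k : ℕ) : ℕ → ℝ[X] := fun n => ∑ i ∈ Finset.Icc 1 n, (X ^ i) ^ k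

/-- The `r`-th elementary symmetric functions of `X, X ^ 2, …, X ^ n`, as a family in `n`. -/
noncomputable def esymmFamily (r : ℕ) : ℕ → ℝ[X] :=
  fun n => ∑ t ∈ (Finset.Icc 1 n).powersetCard r, ∏ i ∈ t, X ^ i

theorem esymmFamily_newton (r : ℕ) :
    (r : ℝ) • esymmFamily r = ∑ a ∈ Finset.HasAntidiagonal.antidiagonal r with a.1 < r,
      (-1 : ℝ) ^ (r + 1 + a.1) • (esymmFamily a.1 * psumFamily a.2) := by
  ext1 n
  have he : ∀ k, MvPolynomial.aeval (fun i : Finset.Icc 1 n => (X ^ (i : ℕ) : ℝ[X]))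
      (MvPolynomial.esymm (Finset.Icc 1 n) ℝ k) = esymmFamily k n := by
    intro k
    rw [MvPolynomial.aeval_esymm_eq_multiset_esymm, esymmFamily, ← Finset.esymm_map_val]
    rw [Finset.univ_eq_attach]
    exact congrArg (Multiset.esymm · k)
      (Multiset.attach_map_val' (Finset.Icc 1 n).val fun i => (X ^ i : ℝ[X]))
  have hp : ∀ k, MvPolynomial.aeval (fun i : Finset.Icc 1 n => (X ^ (i : ℕ) : ℝ[X]))
      (MvPolynomial.psum (Finset.Icc 1 n) ℝ k) = psumFamily k n := by
    intro k
    rw [MvPolynomial.psum, map_sum, psumFamily]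
    simp only [map_pow, MvPolynomial.aeval_X]
    exact Finset.sum_coe_sort _ fun i => (X ^ i : ℝ[X]) ^ k
  have := congrArg (MvPolynomial.aeval (fun i : Finset.Icc 1 n => (X ^ (i : ℕ) : ℝ[X])))
    (MvPolynomial.mul_esymm_eq_sum (Finset.Icc 1 n) ℝ r)
  simp only [map_mul, map_natCast, map_sum, map_pow, map_neg, map_one, he, hp] at this
  rw [Pi.smul_apply, Finset.sum_apply, Nat.cast_smul_eq_nsmul, nsmul_eq_mul, this,
    Finset.mul_sum]
  refine Finset.sum_congr rfl fun a _ => ?_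
  rw [Pi.smul_apply, Pi.mul_apply, smul_eq_C_mul, C_pow, C_neg, C_1, pow_add (-1 : ℝ[X]) (r + 1),
    mul_assoc, mul_assoc]

/-- The span of the products of fewer than `m` power sums of positive degrees whose total is at
most `r`. -/
noncomputable def powerSumSpan (r m : ℕ) : Submodule ℝ (ℕ → ℝ[X]) :=
  Submodule.span ℝ {F | ∃ s : Multiset ℕ, (∀ k ∈ s, 1 ≤ k) ∧ s.sum ≤ r ∧ s.card < m ∧
    F = (s.map psumFamily).prod}

theorem powerSumSpan_mono {r r' m m' : ℕ} (hr : r ≤ r') (hm : m ≤ m') :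
    powerSumSpan r m ≤ powerSumSpan r' m' :=
  Submodule.span_mono fun _ ⟨s, h1, h2, h3, h4⟩ => ⟨s, h1, h2.trans hr, h3.trans_le hm, h4⟩

theorem mul_psumFamily_mem {r m k : ℕ} (hk : 1 ≤ k) {F : ℕ → ℝ[X]} (hF : F ∈ powerSumSpan r m) :
    F * psumFamily k ∈ powerSumSpan (r + k) (m + 1) := by
  refine Submodule.span_induction (p := fun F _ => F * psumFamily k ∈ powerSumSpan (r + k) (m + 1))
    ?_ ?_ ?_ ?_ hF
  · rintro _ ⟨s, h1, h2, h3, rfl⟩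
    refine Submodule.subset_span ⟨k ::ₘ s, ?_, ?_, ?_, ?_⟩
    · simpa using ⟨hk, h1⟩
    · rw [Multiset.sum_cons]
      omega
    · rw [Multiset.card_cons]
      omega
    · rw [Multiset.map_cons, Multiset.prod_cons, mul_comm]
  · rw [zero_mul]
    exact Submodule.zero_mem _
  · intro F G _ _ hF hG
    rw [add_mul]
    exact Submodule.add_mem _ hF hG
  · intro a F _ hF
    rw [smul_mul_assoc]
    exact Submodule.smul_mem _ _ hF

theorem psumFamily_one_pow_mem (r : ℕ) : psumFamily 1 ^ r ∈ powerSumSpan r (r + 1) :=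
  Submodule.subset_span ⟨Multiset.replicate r 1,
    fun k hk => (Multiset.eq_of_mem_replicate hk).ge, by simp, by simp, by simp⟩

theorem esymmFamily_sub_mem (r : ℕ) :
    esymmFamily r - (r.factorial : ℝ)⁻¹ • psumFamily 1 ^ r ∈ powerSumSpan r r := by
  induction r using Nat.strong_induction_on with
  | _ r ih =>
    rcases r with _ | r
    · have : esymmFamily 0 - ((Nat.factorial 0 : ℕ) : ℝ)⁻¹ • psumFamily 1 ^ 0 = 0 := by
        ext1 n
        simp [esymmFamily]
      rw [this]
      exact Submodule.zero_mem _
    have mem : ∀ k < r + 1, esymmFamily k ∈ powerSumSpan k (k + 1) := by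
      intro k hk
      have := Submodule.add_mem _ (powerSumSpan_mono le_rfl (Nat.le_succ k) (ih k hk))
        (Submodule.smul_mem _ (k.factorial : ℝ)⁻¹ (psumFamily_one_pow_mem k))
      rwa [sub_add_cancel] at this
    have newton := esymmFamily_newton (r + 1)
    rw [← Finset.add_sum_erase _ _ (a := (r, 1)) (by simp)] at newton
    have hsign : (-1 : ℝ) ^ (r + 1 + 1 + r) = 1 := Even.neg_one_pow ⟨r + 1, by ring⟩
    rw [hsign, one_smul] at newton
    have hr : ((r + 1 : ℕ) : ℝ) ≠ 0 := by positivity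
    have hfac : ((r + 1).factorial : ℝ)⁻¹ = ((r + 1 : ℕ) : ℝ)⁻¹ * (r.factorial : ℝ)⁻¹ := by
      rw [Nat.factorial_succ, Nat.cast_mul, mul_inv]
    rw [← inv_smul_smul₀ hr (esymmFamily (r + 1)), newton, hfac, mul_smul, ← smul_sub,
      add_sub_right_comm]
    refine Submodule.smul_mem _ _ (Submodule.add_mem _ ?_ (Submodule.sum_mem _ ?_))
    · rw [pow_succ, ← smul_mul_assoc, ← sub_mul]
      exact mul_psumFamily_mem le_rfl (ih r (Nat.lt_succ_self r))
    · rintro ⟨i, j⟩ ha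
      simp only [Finset.mem_erase, Finset.mem_filter, Finset.HasAntidiagonal.mem_antidiagonal, Prod.mk.injEq,
        ne_eq] at ha
      refine Submodule.smul_mem _ _ (powerSumSpan_mono ?_ ?_
        (mul_psumFamily_mem (by omega) (mem i (by omega)))) <;> omega

theorem esymmFamily_mem (r : ℕ) : esymmFamily r ∈ powerSumSpan r (r + 1) := by
  have := Submodule.add_mem _ (powerSumSpan_mono le_rfl (Nat.le_succ r) (esymmFamily_sub_mem r))
    (Submodule.smul_mem _ (r.factorial : ℝ)⁻¹ (psumFamily_one_pow_mem r))
  rwa [sub_add_cancel] at this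

/-- All coefficients of `F` are at most `C` in absolute value. -/
def CoeffBound (F : ℝ[X]) (C : ℝ) : Prop := ∀ k, |F.coeff k| ≤ C

theorem CoeffBound.mono {F : ℝ[X]} {C D : ℝ} (h : CoeffBound F C) (hCD : C ≤ D) :
    CoeffBound F D := fun k => (h k).trans hCD

theorem CoeffBound.nonneg {F : ℝ[X]} {C : ℝ} (h : CoeffBound F C) : 0 ≤ C :=
  (abs_nonneg _).trans (h 0)

theorem CoeffBound.add {F G : ℝ[X]} {C D : ℝ} (hF : CoeffBound F C) (hG : CoeffBound G D) :
    CoeffBound (F + G) (C + D) := fun k => by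
  rw [coeff_add]
  exact (abs_add_le _ _).trans (add_le_add (hF k) (hG k))

theorem CoeffBound.smul {F : ℝ[X]} {C : ℝ} (hF : CoeffBound F C) (a : ℝ) :
    CoeffBound (a • F) (|a| * C) := fun k => by
  rw [coeff_smul, smul_eq_mul, abs_mul]
  exact mul_le_mul_of_nonneg_left (hF k) (abs_nonneg a)

theorem CoeffBound.X_pow_mul {F : ℝ[X]} {C : ℝ} (hF : CoeffBound F C) (a : ℕ) :
    CoeffBound (X ^ a * F) C := fun k => by
  rw [coeff_X_pow_mul']
  split_ifs
  · exact hF _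
  · rw [abs_zero]
    exact hF.nonneg

theorem CoeffBound.X_pow_sub_X_pow_mul {F : ℝ[X]} {C : ℝ} (hF : CoeffBound F C) (a b : ℕ) :
    CoeffBound ((X ^ a - X ^ b) * F) (2 * C) := by
  rw [show (X ^ a - X ^ b) * F = X ^ a * F + (-1 : ℝ) • (X ^ b * F) by
    rw [neg_one_smul, sub_mul, sub_eq_add_neg]]
  exact ((hF.X_pow_mul a).add ((hF.X_pow_mul b).smul (-1))).mono (by norm_num; linarith)

theorem CoeffBound.one_sub_X_mul {F : ℝ[X]} {C : ℝ} (hF : CoeffBound F C) :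
    CoeffBound ((1 - X) * F) (2 * C) := by
  simpa using hF.X_pow_sub_X_pow_mul 0 1

theorem CoeffBound.psumFamily_mul {F : ℝ[X]} {C : ℝ} (hF : CoeffBound F C) (k n : ℕ) :
    CoeffBound (psumFamily k n * F) (n * C) := fun ℓ => by
  rw [psumFamily, Finset.sum_mul, finsetSum_coeff]
  calc _ ≤ ∑ i ∈ Finset.Icc 1 n, |((X ^ i) ^ k * F).coeff ℓ| := 
      Finset.abs_sum_le_sum_abs (fun i => ((X ^ i) ^ k * F).coeff ℓ) _
    _ ≤ ∑ i ∈ Finset.Icc 1 n, C := by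
      refine Finset.sum_le_sum fun i _ => ?_
      rw [← pow_mul]
      exact hF.X_pow_mul _ _
    _ = n * C := by simp

theorem coeffBound_psumFamily {k : ℕ} (hk : 1 ≤ k) (n : ℕ) : CoeffBound (psumFamily k n) 1 := by
  intro ℓ
  rw [psumFamily, finsetSum_coeff]
  simp only [← pow_mul, coeff_X_pow]
  rw [← Finset.sum_filter, Finset.sum_const, nsmul_one, Nat.abs_cast, Nat.cast_le_one,
    Finset.card_le_one]
  intro i hi j hj
  simp only [Finset.mem_filter] at hi hj
  exact Nat.eq_of_mul_eq_mul_right hk (hi.2.symm.trans hj.2)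

theorem coeffBound_prod_psumFamily {n : ℕ} (s : Multiset ℕ) (hs : ∀ k ∈ s, 1 ≤ k) :
    CoeffBound ((s.map psumFamily).prod n) ((n : ℝ) ^ (s.card - 1)) := by
  induction s using Multiset.induction_on with
  | empty =>
    intro k
    simp only [Multiset.map_zero, Multiset.prod_zero, Pi.one_apply, coeff_one]
    split_ifs <;> simp
  | cons k s ih =>
    rw [Multiset.map_cons, Multiset.prod_cons, Pi.mul_apply, Multiset.card_cons,
      Nat.add_sub_cancel]
    rcases Multiset.empty_or_exists_mem s with rfl | ⟨a, ha⟩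
    · simpa using coeffBound_psumFamily (hs k (by simp)) n
    · have := (ih fun k hk => hs k (Multiset.mem_cons_of_mem hk)).psumFamily_mul k n
      rwa [← pow_succ', Nat.sub_add_cancel (Multiset.card_pos_iff_exists_mem.2 ⟨a, ha⟩)] at this

theorem one_sub_X_mul_psumFamily_one (n : ℕ) :
    (1 - X) * psumFamily 1 n = X ^ 1 - X ^ (n + 1) := by
  induction n with
  | zero => simp [psumFamily]
  | succ n ih =>
    rw [psumFamily, Finset.sum_Icc_succ_top (by omega), mul_add]
    rw [psumFamily] at ih
    rw [ih]
    ring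

/-- The families whose coefficients are of order `n ^ (e + 2)`, each of the first two difference
operators gaining a factor `n`. -/
def smoothFamilies (e : ℕ) : Submodule ℝ (ℕ → ℝ[X]) where
  carrier := {F | ∃ C : ℝ, ∀ n : ℕ, 1 ≤ n → CoeffBound (F n) (C * (n : ℝ) ^ (e + 2)) ∧
    CoeffBound ((1 - X) * F n) (C * (n : ℝ) ^ (e + 1)) ∧
    CoeffBound ((1 - X) * ((1 - X) * F n)) (C * (n : ℝ) ^ e)}
  zero_mem' := ⟨0, fun n _ => by simp [CoeffBound]⟩
  add_mem' := by
    rintro F G ⟨C, hC⟩ ⟨D, hD⟩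
    refine ⟨C + D, fun n hn => ?_⟩
    obtain ⟨h0, h1, h2⟩ := hC n hn
    obtain ⟨k0, k1, k2⟩ := hD n hn
    simp only [Pi.add_apply, mul_add, add_mul]
    exact ⟨h0.add k0, by simpa only [mul_add] using h1.add k1,
      by simpa only [mul_add] using h2.add k2⟩
  smul_mem' := by
    rintro a F ⟨C, hC⟩
    refine ⟨|a| * C, fun n hn => ?_⟩
    obtain ⟨h0, h1, h2⟩ := hC n hn
    simp only [Pi.smul_apply, mul_smul_comm, mul_assoc |a|]
    exact ⟨h0.smul a, h1.smul a, h2.smul a⟩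

theorem mem_smoothFamilies_of_bounds {e i j k : ℕ} {F : ℕ → ℝ[X]} (hi : i ≤ e + 2) (hj : j ≤ e + 1)
    (hk : k ≤ e) (h : ∀ n : ℕ, CoeffBound (F n) ((n : ℝ) ^ i) ∧
      CoeffBound ((1 - X) * F n) (2 * (n : ℝ) ^ j) ∧
      CoeffBound ((1 - X) * ((1 - X) * F n)) (4 * (n : ℝ) ^ k)) : F ∈ smoothFamilies e := by
  refine ⟨4, fun n hn => ?_⟩
  have hn' : (1 : ℝ) ≤ n := by exact_mod_cast hn
  obtain ⟨h0, h1, h2⟩ := h n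
  have hpow : ∀ {p q : ℕ}, p ≤ q → (n : ℝ) ^ p ≤ (n : ℝ) ^ q := fun h => pow_le_pow_right₀ hn' h
  refine ⟨h0.mono ?_, h1.mono ?_, h2.mono ?_⟩
  · linarith [hpow hi, pow_nonneg (zero_le_one.trans hn') (e + 2)]
  · linarith [hpow hj, pow_nonneg (zero_le_one.trans hn') (e + 1)]
  · linarith [hpow hk]

theorem two_ones_mem_smoothFamilies {e : ℕ} {s : Multiset ℕ} (hs : ∀ k ∈ s, 1 ≤ k)
    (hc : s.card ≤ e + 1) :
    ((1 ::ₘ 1 ::ₘ s).map psumFamily).prod ∈ smoothFamilies e := by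
  refine mem_smoothFamilies_of_bounds (i := s.card + 1) (j := s.card) (k := s.card - 1)
    (by omega) (by omega) (by omega) fun n => ?_
  have h2 := coeffBound_prod_psumFamily (n := n) s hs
  have h1 := coeffBound_prod_psumFamily (n := n) (1 ::ₘ s) (by simpa using hs)
  have h0 := coeffBound_prod_psumFamily (n := n) (1 ::ₘ 1 ::ₘ s) (by simpa using hs)
  simp only [Multiset.map_cons, Multiset.prod_cons, Pi.mul_apply, Multiset.card_cons,
    Nat.add_sub_cancel] at h0 h1 h2 ⊢
  refine ⟨h0, ?_, ?_⟩
  · rw [← mul_assoc, one_sub_X_mul_psumFamily_one]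
    exact h1.X_pow_sub_X_pow_mul _ _
  · rw [← mul_assoc (1 - X) (psumFamily 1 n), one_sub_X_mul_psumFamily_one, mul_left_comm,
      ← mul_assoc (1 - X) (psumFamily 1 n), one_sub_X_mul_psumFamily_one]
    exact ((h2.X_pow_sub_X_pow_mul _ _).X_pow_sub_X_pow_mul _ _).mono (by linarith)

theorem two_mul_card_le_sum {s : Multiset ℕ} (hs : ∀ k ∈ s, 1 ≤ k) (h1 : 1 ∉ s) :
    2 * s.card ≤ s.sum := by
  have := Multiset.card_nsmul_le_sum (s := s) (a := 2) fun k hk => by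
    have := hs k hk
    have : k ≠ 1 := fun h => h1 (h ▸ hk)
    omega
  rwa [smul_eq_mul, mul_comm] at this

theorem powerSumSpan_le_smoothFamilies {e : ℕ} (he : 1 ≤ e) :
    powerSumSpan (e + 4) (e + 4) ≤ smoothFamilies e := by
  refine Submodule.span_le.2 ?_
  rintro _ ⟨s, hs, hsum, hcard, rfl⟩
  by_cases h1 : 1 ∈ s
  · obtain ⟨t, rfl⟩ := Multiset.exists_cons_of_mem h1
    have ht : ∀ k ∈ t, 1 ≤ k := fun k hk => hs k (Multiset.mem_cons_of_mem hk)
    rw [Multiset.sum_cons] at hsum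
    rw [Multiset.card_cons] at hcard
    by_cases h2 : 1 ∈ t
    · obtain ⟨u, rfl⟩ := Multiset.exists_cons_of_mem h2
      rw [Multiset.card_cons] at hcard
      exact two_ones_mem_smoothFamilies (fun k hk => ht k (Multiset.mem_cons_of_mem hk)) (by omega)
    · have hc := two_mul_card_le_sum ht h2
      refine mem_smoothFamilies_of_bounds (i := t.card) (j := t.card - 1) (k := t.card - 1)
        (by omega) (by omega) (by omega) fun n => ?_
      have b0 := coeffBound_prod_psumFamily (n := n) (1 ::ₘ t) hs
      have b1 := coeffBound_prod_psumFamily (n := n) t ht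
      simp only [Multiset.map_cons, Multiset.prod_cons, Pi.mul_apply, Multiset.card_cons,
        Nat.add_sub_cancel] at b0 ⊢
      have b2 := b1.X_pow_sub_X_pow_mul 1 (n + 1)
      rw [← mul_assoc (1 - X), one_sub_X_mul_psumFamily_one]
      exact ⟨b0, b2, b2.one_sub_X_mul.mono (by linarith)⟩
  · have hc := two_mul_card_le_sum hs h1
    refine mem_smoothFamilies_of_bounds (i := s.card - 1) (j := s.card - 1) (k := s.card - 1)
      (by omega) (by omega) (by omega) fun n => ?_
    have b0 := coeffBound_prod_psumFamily (n := n) s hs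
    exact ⟨b0, b0.one_sub_X_mul, b0.one_sub_X_mul.one_sub_X_mul.mono (by linarith)⟩

theorem psumFamily_one_pow_mem_smoothFamilies (e : ℕ) :
    psumFamily 1 ^ (e + 3) ∈ smoothFamilies e := by
  have := two_ones_mem_smoothFamilies (e := e) (s := Multiset.replicate (e + 1) 1)
    (fun k hk => (Multiset.eq_of_mem_replicate hk).ge) (by simp)
  simpa [pow_succ', mul_assoc] using this

theorem coeff_psumFamily_one_pow (n b ℓ : ℕ) :
    ((psumFamily 1 ^ b) n).coeff ℓ = tupleCount n b ℓ := by
  induction b generalizing ℓ with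
  | zero => simp [tupleCount, coeff_one]
  | succ b ih =>
    rw [pow_succ', Pi.mul_apply, psumFamily, Finset.sum_mul, finsetSum_coeff, tupleCount,
      ← Finset.Ico_succ_right_eq_Icc, Finset.sum_Ico_eq_sum_range]
    refine Finset.sum_congr rfl fun j _ => ?_
    rw [pow_one, coeff_X_pow_mul']
    split_ifs with h
    · rw [ih, Nat.cast_sub h]
      push_cast
      rw [add_comm (1 : ℤ)]
    · rw [tupleCount_of_neg _ _ (by omega)]

theorem coeff_sum_esymmFamily (n b ℓ : ℕ) :
    ((∑ r ∈ Finset.range (b + 1), esymmFamily r) n).coeff ℓ = truncStaircaseCount n b ℓ := by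
  rw [truncStaircaseCount, Finset.sum_apply, finsetSum_coeff]
  rw [Finset.card_eq_sum_card_fiberwise (f := Finset.card) (t := Finset.range (b + 1))
    (fun s hs => Finset.mem_coe.2 (Finset.mem_range_succ_iff.2
      (Finset.mem_filter.1 (Finset.mem_coe.1 hs)).2.1)), Nat.cast_sum]
  refine Finset.sum_congr rfl fun r hr => ?_
  have hr := Finset.mem_range.1 hr
  rw [esymmFamily, finsetSum_coeff]
  have hprod : ∀ s : Finset ℕ, ∏ i ∈ s, (X : ℝ[X]) ^ i = X ^ s.sum id := fun s =>
    Finset.prod_pow_eq_pow_sum s id X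
  simp only [hprod, coeff_X_pow]
  rw [← Finset.sum_filter, Finset.sum_const, nsmul_one]
  congr 2
  ext s
  simp only [Finset.mem_filter, Finset.mem_powersetCard, Finset.mem_powerset, id]
  constructor
  · rintro ⟨⟨h1, h2⟩, h3⟩
    exact ⟨⟨h1, by omega, h3.symm⟩, h2⟩
  · rintro ⟨⟨h1, _, h3⟩, h2⟩
    exact ⟨⟨h1, h2⟩, h3.symm⟩

theorem coeff_one_sub_X_mul (F : ℝ[X]) (k : ℕ) :
    ((1 - X) * F).coeff (k + 1) = F.coeff (k + 1) - F.coeff k := by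
  rw [sub_mul, one_mul, coeff_sub, coeff_X_mul]

end GeneratingFunctions

/-- A positive log-concavity defect of order `n ^ 4` survives a perturbation that is smaller by a
factor `n` together with its first two differences. -/
theorem defect_add_le {u₀ u₁ u₂ v₀ v₁ v₂ A C E n : ℝ}
    (hu : |u₁| ≤ A * (E * n ^ 3)) (hu₀ : |u₁ - u₀| ≤ A * (E * n ^ 2))
    (hu₁ : |u₂ - u₁| ≤ A * (E * n ^ 2)) (hu₂ : |u₂ - u₁ - (u₁ - u₀)| ≤ A * (E * n))
    (hv : |v₁| ≤ C * (E * n ^ 2)) (hv₀ : |v₁ - v₀| ≤ C * (E * n))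
    (hv₁ : |v₂ - v₁| ≤ C * (E * n)) (hv₂ : |v₂ - v₁ - (v₁ - v₀)| ≤ C * E)
    (hn : 1 ≤ n) (h : (4 * A * C + 2 * C ^ 2) * E ^ 2 * n ^ 3 ≤ u₁ ^ 2 - u₀ * u₂) :
    (u₀ + v₀) * (u₂ + v₂) ≤ (u₁ + v₁) ^ 2 := by
  have hmul : ∀ {x y a b : ℝ}, |x| ≤ a → |y| ≤ b → |x * y| ≤ a * b := fun hx hy => by
    rw [abs_mul]
    exact mul_le_mul hx hy (abs_nonneg _) ((abs_nonneg _).trans hx)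
  have t₁ := (abs_le.1 (hmul hu hv₂)).2
  have t₂ := (abs_le.1 (hmul hv hu₂)).2
  have t₃ := (abs_le.1 (hmul hv hv₂)).2
  have t₄ := (abs_le.1 (hmul hu₀ hv₁)).1
  have t₅ := (abs_le.1 (hmul hv₀ hu₁)).1
  have t₆ := (abs_le.1 (hmul hv₀ hv₁)).1
  have hpow : (C * E) ^ 2 * n ^ 2 ≤ (C * E) ^ 2 * n ^ 3 := by
    gcongr
    norm_num
  linarith

/-- For every `b ≥ 5` there is `N` such that for all `n ≥ N` and all integers `ℓ` with
`(1728/1729)·n ≤ ℓ ≤ (b − 1728/1729)·n`, the count `c_{n,b}(ℓ)` is log-concave at `ℓ`: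
`c_{n,b}(ℓ)² ≥ c_{n,b}(ℓ−1)·c_{n,b}(ℓ+1)`. -/
theorem bulk_log_concave (b : ℕ) (hb : 5 ≤ b) :
    ∃ N : ℕ, ∀ n : ℕ, N ≤ n → ∀ ℓ : ℕ,
      (1728 / 1729 : ℝ) * n ≤ (ℓ : ℝ) → (ℓ : ℝ) ≤ ((b : ℝ) - 1728 / 1729) * n →
      truncStaircaseCount n b (ℓ - 1) * truncStaircaseCount n b (ℓ + 1) ≤
        truncStaircaseCount n b ℓ ^ 2 := by
  obtain ⟨e, rfl⟩ := Nat.exists_eq_add_of_le' (show 4 ≤ b by omega)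
  set fac : ℝ := ((e + 4).factorial : ℝ) with hfac
  have hfac0 : 0 < fac := by positivity
  set U : ℕ → Polynomial ℝ := fac⁻¹ • psumFamily 1 ^ (e + 4) with hU
  set V : ℕ → Polynomial ℝ := ∑ r ∈ Finset.range (e + 4 + 1), esymmFamily r - U with hV
  have hUmem : U ∈ smoothFamilies (e + 1) :=
    Submodule.smul_mem _ _ (psumFamily_one_pow_mem_smoothFamilies (e + 1))
  have hVmem : V ∈ smoothFamilies e := by
    refine powerSumSpan_le_smoothFamilies (by omega) ?_
    rw [hV, Finset.sum_range_succ, add_sub_assoc]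
    refine Submodule.add_mem _ (Submodule.sum_mem _ fun r hr => ?_) (esymmFamily_sub_mem (e + 4))
    have := Finset.mem_range.1 hr
    exact powerSumSpan_mono (by omega) (by omega) (esymmFamily_mem r)
  obtain ⟨A, hA⟩ := hUmem
  obtain ⟨C, hC⟩ := hVmem
  obtain ⟨c, hc, N₁, hN₁⟩ := tupleCount_bulk (e + 2) (1 / 2) (by norm_num) le_rfl
  obtain ⟨N₂, hN₂⟩ := exists_nat_ge ((4 * A * C + 2 * C ^ 2) * fac ^ 2 / c)
  refine ⟨max (max N₁ N₂) 2, fun n hn ℓ h1 h2 => ?_⟩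
  have hn₁ : N₁ ≤ n := by omega
  have hn₂ : (N₂ : ℝ) ≤ n := by exact_mod_cast (by omega : N₂ ≤ n)
  have hn' : (2 : ℝ) ≤ n := by exact_mod_cast (by omega : 2 ≤ n)
  have hℓ : 0 < ℓ := by
    have : (0 : ℝ) < ℓ := by linarith
    exact_mod_cast this
  obtain ⟨k, rfl⟩ := Nat.exists_eq_add_of_le' hℓ
  rw [Nat.add_sub_cancel]
  have hcount : ∀ j, (truncStaircaseCount n (e + 4) j : ℝ) = (U n).coeff j + (V n).coeff j := by
    intro j
    rw [← Polynomial.coeff_add, ← Pi.add_apply, hV, add_sub_cancel, coeff_sum_esymmFamily]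
  have hUcoeff : ∀ j : ℕ, (U n).coeff j = fac⁻¹ * tupleCount n (e + 4) j := by
    intro j
    rw [hU, Pi.smul_apply, Polynomial.coeff_smul, coeff_psumFamily_one_pow, smul_eq_mul]
  have hdefect := (hN₁ n hn₁ (k + 1) (by push_cast at h1 ⊢; linarith)
    (by push_cast at h2 ⊢; linarith)).2
  obtain ⟨a0, a1, a2⟩ := hA n (by omega)
  obtain ⟨c0, c1, c2⟩ := hC n (by omega)
  have a0 := a0 (k + 1)
  have a1' := a1 (k + 1 + 1)
  have a1 := a1 (k + 1)
  have a2 := a2 (k + 1 + 1)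
  have c0 := c0 (k + 1)
  have c1' := c1 (k + 1 + 1)
  have c1 := c1 (k + 1)
  have c2 := c2 (k + 1 + 1)
  simp only [coeff_one_sub_X_mul] at a1 a1' a2 c1 c1' c2
  have main : (truncStaircaseCount n (e + 4) k * truncStaircaseCount n (e + 4) (k + 1 + 1) : ℝ) ≤
      (truncStaircaseCount n (e + 4) (k + 1) : ℝ) ^ 2 := by
    simp only [hcount]
    refine defect_add_le (A := A) (C := C) (E := (n : ℝ) ^ e) (n := n) (a0.trans_eq (by ring))
      (a1.trans_eq (by ring)) (a1'.trans_eq (by ring)) (a2.trans_eq (by ring))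
      (c0.trans_eq (by ring)) (c1.trans_eq (by ring)) (c1'.trans_eq (by ring)) c2
      (by linarith) ?_
    rw [hUcoeff, hUcoeff, hUcoeff]
    push_cast
    rw [add_sub_cancel_right] at hdefect
    have hbig := (div_le_iff₀ hc).1 (hN₂.trans hn₂)
    calc (4 * A * C + 2 * C ^ 2) * ((n : ℝ) ^ e) ^ 2 * n ^ 3
        = (4 * A * C + 2 * C ^ 2) * fac ^ 2 * (fac⁻¹ ^ 2 * ((n : ℝ) ^ e) ^ 2 * n ^ 3) := by
          field_simp
      _ ≤ n * c * (fac⁻¹ ^ 2 * ((n : ℝ) ^ e) ^ 2 * n ^ 3) := by gcongr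
      _ = fac⁻¹ ^ 2 * (c * (n : ℝ) ^ (2 * (e + 2))) := by ring
      _ ≤ fac⁻¹ ^ 2 * (tupleCount n (e + 2 + 2) (k + 1) ^ 2 -
          tupleCount n (e + 2 + 2) k * tupleCount n (e + 2 + 2) (k + 1 + 1)) := by gcongr
      _ = _ := by ring
  exact_mod_cast main
end

section
/- For every integer b ≥ 5 there exists a constant C_b > 0 and N such that for all n ≥ N and all integers ℓ with (1728/1729)·n ≤ ℓ ≤ (b − 1728/1729)·n, one has | c_{n,b}(ℓ) − (n^{b−1}/b!) · I( ℓ/n − b(b+1)/(2n) ) | ≤ C_b · n^{b−2}, where I := χ_{[0,1]}^{∗b} is the b-fold convolution power of the indicator function of [0,1]. -/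
open MeasureTheory

/-- `convSelf f k` is the `(k+1)`-fold convolution power `f ∗ f ∗ ⋯ ∗ f` (`k+1` factors);
in particular `convSelf f (b-1)` is the `b`-fold convolution power `f^{∗b}` for `b ≥ 1`. -/
noncomputable def convSelf (f : ℝ → ℝ) : ℕ → ℝ → ℝ
  | 0 => f
  | k + 1 => conv (convSelf f k) f

open scoped Nat

/-- The `k`-element subsets of `{1, …, n}` whose elements sum to `m`. -/
def subsetsWithSum (n k : ℕ) (m : ℤ) : Finset (Finset ℕ) :=
  ((Finset.Icc 1 n).powersetCard k).filter (fun s => ∑ i ∈ s, (i : ℤ) = m)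

lemma mem_subsetsWithSum {n k : ℕ} {m : ℤ} {s : Finset ℕ} :
    s ∈ subsetsWithSum n k m ↔
      (s ⊆ Finset.Icc 1 n ∧ s.card = k) ∧ ∑ i ∈ s, (i : ℤ) = m := by
  simp [subsetsWithSum, Finset.mem_powersetCard]

lemma card_filter_mem_subsetsWithSum {n k j : ℕ} (m : ℤ) (hj : j ∈ Finset.Icc 1 n) :
    ((subsetsWithSum n (k + 1) m).filter (fun s => j ∈ s)).card =
      ((subsetsWithSum n k (m - j)).filter (fun s => j ∉ s)).card := by
  refine Finset.card_nbij' (fun s => s.erase j) (fun s => insert j s) ?_ ?_ ?_ ?_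
  · intro s hs
    simp only [Finset.coe_filter, Set.mem_ofPred_eq, mem_subsetsWithSum] at hs ⊢
    obtain ⟨⟨⟨h1, h2⟩, h3⟩, h4⟩ := hs
    refine ⟨⟨⟨(Finset.erase_subset _ _).trans h1, ?_⟩, ?_⟩, Finset.notMem_erase _ _⟩
    · rw [Finset.card_erase_of_mem h4, h2]; rfl
    · have := Finset.sum_erase_add s (fun i => (i : ℤ)) h4
      linarith
  · intro s hs
    simp only [Finset.coe_filter, Set.mem_ofPred_eq, mem_subsetsWithSum] at hs ⊢
    obtain ⟨⟨⟨h1, h2⟩, h3⟩, h4⟩ := hs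
    refine ⟨⟨⟨Finset.insert_subset hj h1, ?_⟩, ?_⟩, Finset.mem_insert_self _ _⟩
    · rw [Finset.card_insert_of_notMem h4, h2]
    · rw [Finset.sum_insert h4, h3]; ring
  · intro s hs
    simp only [Finset.coe_filter, Set.mem_ofPred_eq] at hs
    exact Finset.insert_erase hs.2
  · intro s hs
    simp only [Finset.coe_filter, Set.mem_ofPred_eq] at hs
    exact Finset.erase_insert hs.2

lemma succ_mul_card_subsetsWithSum (n k : ℕ) (m : ℤ) :
    (k + 1) * (subsetsWithSum n (k + 1) m).card =
      ∑ j ∈ Finset.Icc 1 n, ((subsetsWithSum n k (m - j)).filter (fun s => j ∉ s)).card := by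
  have h := Finset.sum_card_bipartiteAbove_eq_sum_card_bipartiteBelow
    (s := subsetsWithSum n (k + 1) m) (t := Finset.Icc 1 n) (fun s j => j ∈ s)
  have hl : ∀ s ∈ subsetsWithSum n (k + 1) m,
      (Finset.bipartiteAbove (fun (s : Finset ℕ) j => j ∈ s) (Finset.Icc 1 n) s).card = k + 1 := by
    intro s hs
    obtain ⟨⟨h1, h2⟩, -⟩ := mem_subsetsWithSum.1 hs
    rw [← h2, Finset.bipartiteAbove, Finset.filter_mem_eq_inter, Finset.inter_eq_right.2 h1]
  rw [Finset.sum_congr rfl hl, Finset.sum_const, smul_eq_mul, mul_comm] at h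
  rw [h]
  exact Finset.sum_congr rfl fun j hj => card_filter_mem_subsetsWithSum m hj

lemma succ_mul_card_add_eq_sum (n k : ℕ) (m : ℤ) :
    (k + 1) * (subsetsWithSum n (k + 1) m).card +
        ∑ j ∈ Finset.Icc 1 n, ((subsetsWithSum n k (m - j)).filter (fun s => j ∈ s)).card =
      ∑ j ∈ Finset.Icc 1 n, (subsetsWithSum n k (m - j)).card := by
  rw [succ_mul_card_subsetsWithSum, ← Finset.sum_add_distrib]
  refine Finset.sum_congr rfl fun j _ => ?_
  rw [add_comm, Finset.card_filter_add_card_filter_not]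

lemma card_subsetsWithSum_zero_le (n : ℕ) (m : ℤ) : (subsetsWithSum n 0 m).card ≤ 1 := by
  simpa [subsetsWithSum] using Finset.card_filter_le ({∅} : Finset (Finset ℕ)) _

lemma card_subsetsWithSum_one (n : ℕ) (m : ℤ) :
    (subsetsWithSum n 1 m).card = if 1 ≤ m ∧ m ≤ n then 1 else 0 := by
  split_ifs with h
  · rw [Finset.card_eq_one]
    refine ⟨{m.toNat}, ?_⟩
    ext s
    rw [mem_subsetsWithSum, Finset.card_eq_one, Finset.mem_singleton]
    constructor
    · rintro ⟨⟨-, a, rfl⟩, h3⟩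
      simp at h3
      simp [← h3]
    · rintro rfl
      refine ⟨⟨?_, _, rfl⟩, ?_⟩
      · simp; omega
      · simp; omega
  · rw [Finset.card_eq_zero, Finset.eq_empty_iff_forall_notMem]
    intro s hs
    rw [mem_subsetsWithSum, Finset.card_eq_one] at hs
    obtain ⟨⟨h1, a, rfl⟩, h3⟩ := hs
    simp at h1 h3
    omega

lemma card_subsetsWithSum_succ_le (n k : ℕ) (m : ℤ) :
    (subsetsWithSum n (k + 1) m).card ≤ n ^ k := by
  induction k generalizing m with
  | zero =>
    rw [zero_add, card_subsetsWithSum_one]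
    split_ifs <;> simp
  | succ k ih =>
    have h := succ_mul_card_add_eq_sum n (k + 1) m
    have h2 : ∑ j ∈ Finset.Icc 1 n, (subsetsWithSum n (k + 1) (m - j)).card ≤ n * n ^ k := by
      simpa using Finset.sum_le_card_nsmul (Finset.Icc 1 n)
        (fun j : ℕ => (subsetsWithSum n (k + 1) (m - j)).card) (n ^ k) fun j _ => ih _
    rw [pow_succ']
    exact (Nat.le_mul_of_pos_left _ (by omega)).trans ((Nat.le_add_right _ _).trans (h.le.trans h2))

lemma sum_card_filter_mem_le (n k : ℕ) (m : ℤ) :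
    ∑ j ∈ Finset.Icc 1 n, ((subsetsWithSum n (k + 1) (m - j)).filter (fun s => j ∈ s)).card ≤
      n ^ k := by
  rcases k with _ | k
  · have h : ∀ j ∈ Finset.Icc 1 n,
        ((subsetsWithSum n (0 + 1) (m - j)).filter (fun s => j ∈ s)).card ≤
          if m = 2 * (j : ℤ) then 1 else 0 := by
      intro j hj
      rw [card_filter_mem_subsetsWithSum _ hj]
      split_ifs with h
      · exact (Finset.card_filter_le _ _).trans (card_subsetsWithSum_zero_le _ _)
      · rw [Nat.le_zero, Finset.card_eq_zero, Finset.eq_empty_iff_forall_notMem]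
        intro s hs
        rw [Finset.mem_filter, mem_subsetsWithSum, Finset.card_eq_zero] at hs
        obtain ⟨⟨⟨-, rfl⟩, h2⟩, -⟩ := hs
        simp at h2
        omega
    refine (Finset.sum_le_sum h).trans ?_
    rw [← Finset.card_filter, pow_zero, Finset.card_le_one]
    intro a ha c hc
    have := (Finset.mem_filter.1 ha).2
    have := (Finset.mem_filter.1 hc).2
    omega
  · have h : ∀ j ∈ Finset.Icc 1 n,
        ((subsetsWithSum n (k + 1 + 1) (m - j)).filter (fun s => j ∈ s)).card ≤ n ^ k := by
      intro j hj
      rw [card_filter_mem_subsetsWithSum _ hj]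
      exact (Finset.card_filter_le _ _).trans (card_subsetsWithSum_succ_le _ _ _)
    simpa [pow_succ'] using Finset.sum_le_card_nsmul _ _ _ h

lemma abs_succ_mul_card_sub_sum_le (n k : ℕ) (m : ℤ) :
    |((k : ℝ) + 2) * (subsetsWithSum n (k + 2) m).card -
        ∑ j ∈ Finset.Icc 1 n, ((subsetsWithSum n (k + 1) (m - j)).card : ℝ)| ≤ (n : ℝ) ^ k := by
  have h := succ_mul_card_add_eq_sum n (k + 1) m
  have h2 := sum_card_filter_mem_le n k m
  generalize (∑ j ∈ Finset.Icc 1 n,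
    ((subsetsWithSum n (k + 1) (m - j)).filter (fun s => j ∈ s)).card) = D at h h2
  have h' := congrArg (Nat.cast : ℕ → ℝ) h
  have h2' : (D : ℝ) ≤ (n : ℝ) ^ k := by exact_mod_cast h2
  push_cast at h'
  rw [← h', abs_le]
  have : (0 : ℝ) ≤ D := Nat.cast_nonneg _
  constructor <;> linarith

lemma truncStaircaseCount_eq_sum (n b ℓ : ℕ) :
    truncStaircaseCount n b ℓ = ∑ k ∈ Finset.range (b + 1), (subsetsWithSum n k ℓ).card := by
  rw [truncStaircaseCount, Finset.card_eq_sum_card_fiberwise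
    (f := Finset.card) (t := Finset.range (b + 1))]
  · refine Finset.sum_congr rfl fun k hk => ?_
    congr 1
    ext s
    have : (∑ i ∈ s, (i : ℤ) = ℓ) ↔ s.sum id = ℓ := by
      rw [← Nat.cast_sum]; exact Nat.cast_inj
    simp only [Finset.mem_filter, Finset.mem_powerset, mem_subsetsWithSum, this]
    have := Finset.mem_range.1 hk
    constructor
    · rintro ⟨⟨h1, -, h2⟩, h3⟩; exact ⟨⟨h1, h3⟩, h2⟩
    · rintro ⟨⟨h1, h3⟩, h2⟩; exact ⟨⟨h1, by omega, h2⟩, h3⟩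
  · intro s hs
    have := (Finset.mem_filter.1 hs).2.1
    simp; omega

/-- The indicator function of the unit interval. -/
local notation "χ" => Set.indicator (Set.Icc (0 : ℝ) 1) (fun _ => (1 : ℝ))

lemma conv_indicator_Icc (f : ℝ → ℝ) (x : ℝ) :
    conv f χ x = ∫ u in (0 : ℝ)..1, f (x - u) := by
  rw [conv, ← integral_sub_left_eq_self _ _ x, intervalIntegral.integral_of_le zero_le_one,
    ← integral_Icc_eq_integral_Ioc, ← integral_indicator measurableSet_Icc]
  refine integral_congr_ae (.of_forall fun u => ?_)
  by_cases hu : u ∈ Set.Icc (0 : ℝ) 1 <;> simp [Set.indicator, hu]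

lemma convSelf_indicator_one (x : ℝ) : convSelf χ 1 x = max 0 (1 - |x - 1|) := by
  have h : convSelf χ 1 x = volume.real (Set.Icc (x - 1) x ∩ Set.Icc 0 1) := by
    change conv χ χ x = _
    rw [conv_indicator_Icc, intervalIntegral.integral_of_le zero_le_one,
      ← integral_Icc_eq_integral_Ioc, Set.inter_comm, ← integral_indicator_one (by measurability),
      Set.inter_indicator_one, ← integral_indicator measurableSet_Icc]
    refine integral_congr_ae (.of_forall fun u => ?_)
    have : x - u ∈ Set.Icc (0 : ℝ) 1 ↔ u ∈ Set.Icc (x - 1) x := by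
      simp only [Set.mem_Icc]; constructor <;> rintro ⟨h1, h2⟩ <;> constructor <;> linarith
    simp only [Set.indicator_apply, Pi.mul_apply, this, Pi.one_apply]
    split_ifs <;> norm_num
  rw [h, Set.Icc_inter_Icc, Measure.real, Real.volume_Icc, ENNReal.toReal_ofReal', max_comm]
  rcases le_total x 1 with hx | hx
  · rw [abs_of_nonpos (by linarith), max_eq_right (a := x - 1) (by linarith), min_eq_left hx]
    congr 1; ring
  · rw [abs_of_nonneg (by linarith), max_eq_left (a := x - 1) (by linarith), min_eq_right hx]

lemma abs_convSelf_indicator_sub_le (k : ℕ) (x y : ℝ) :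
    |convSelf χ (k + 1) x - convSelf χ (k + 1) y| ≤ |x - y| := by
  induction k generalizing x y with
  | zero =>
    rw [zero_add, convSelf_indicator_one, convSelf_indicator_one]
    calc _ ≤ |(1 - |x - 1|) - (1 - |y - 1|)| := by
          simpa using abs_max_sub_max_le_max 0 (1 - |x - 1|) 0 (1 - |y - 1|)
      _ = |(|y - 1|) - (|x - 1|)| := by congr 1; ring
      _ ≤ |y - 1 - (x - 1)| := abs_abs_sub_abs_le _ _
      _ = |x - y| := by rw [abs_sub_comm]; congr 1; ring
  | succ k ih =>
    have hc : Continuous (convSelf χ (k + 1)) :=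
      (LipschitzWith.of_dist_le_mul (K := 1) fun x y => by simpa [Real.dist_eq] using ih x y).continuous
    rw [convSelf, conv_indicator_Icc, conv_indicator_Icc, ← intervalIntegral.integral_sub
      (Continuous.intervalIntegrable (by fun_prop) _ _)
      (Continuous.intervalIntegrable (by fun_prop) _ _), ← Real.norm_eq_abs]
    refine (intervalIntegral.norm_integral_le_of_norm_le_const (C := |x - y|)
      fun u _ => ?_).trans_eq (by simp)
    simpa using ih (x - u) (y - u)

lemma abs_sum_sub_integral_le {f : ℝ → ℝ} (hf : ∀ x y, |f x - f y| ≤ |x - y|) {n : ℕ}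
    (hn : 0 < n) (x : ℝ) :
    |∑ j ∈ Finset.Icc 1 n, f (x - j / n) - n * ∫ u in (0 : ℝ)..1, f (x - u)| ≤ 1 := by
  have hc : Continuous f :=
    (LipschitzWith.of_dist_le_mul (K := 1) fun x y => by simpa [Real.dist_eq] using hf x y).continuous
  have hn' : (0 : ℝ) < n := by exact_mod_cast hn
  have hsum : ∑ j ∈ Finset.range n, ∫ u in ((j : ℕ) / n : ℝ)..((j + 1 : ℕ) / n : ℝ), f (x - u) =
      ∫ u in (0 : ℝ)..1, f (x - u) := by
    rw [intervalIntegral.sum_integral_adjacent_intervals (a := fun j : ℕ => (j / n : ℝ))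
      fun k _ => Continuous.intervalIntegrable (by fun_prop) _ _]
    simp [hn'.ne']
  have hIcc : ∑ j ∈ Finset.Icc 1 n, f (x - j / n) =
      ∑ j ∈ Finset.range n, f (x - (j + 1 : ℕ) / n) := by
    rw [← Finset.Ico_add_one_right_eq_Icc, Finset.sum_Ico_eq_sum_range]
    simp [add_comm]
  rw [hIcc, ← hsum, Finset.mul_sum, ← Finset.sum_sub_distrib]
  have hterm : ∀ j ∈ Finset.range n, |f (x - (j + 1 : ℕ) / n) -
      n * ∫ u in ((j : ℕ) / n : ℝ)..((j + 1 : ℕ) / n : ℝ), f (x - u)| ≤ 1 / n := by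
    intro j _
    have hlen : ((j + 1 : ℕ) / n : ℝ) - (j : ℕ) / n = 1 / n := by push_cast; ring
    have hconst : f (x - (j + 1 : ℕ) / n) =
        n * ∫ _ in ((j : ℕ) / n : ℝ)..((j + 1 : ℕ) / n : ℝ), f (x - (j + 1 : ℕ) / n) := by
      rw [intervalIntegral.integral_const, hlen, smul_eq_mul]; field_simp
    rw [hconst, ← mul_sub, ← intervalIntegral.integral_sub
      (Continuous.intervalIntegrable (by fun_prop) _ _)
      (Continuous.intervalIntegrable (by fun_prop) _ _), abs_mul, Nat.abs_cast]
    have hle : ((j : ℕ) / n : ℝ) ≤ (j + 1 : ℕ) / n := by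
      have : (0 : ℝ) < 1 / n := by positivity
      linarith
    have hint := intervalIntegral.norm_integral_le_of_norm_le_const (C := 1 / (n : ℝ))
      (a := ((j : ℕ) / n : ℝ)) (b := ((j + 1 : ℕ) / n : ℝ))
      (f := fun u => f (x - (j + 1 : ℕ) / n) - f (x - u)) fun u hu => by
        rw [Set.uIoc_of_le hle] at hu
        refine (hf _ _).trans ?_
        rw [abs_le]
        constructor <;> linarith [hu.1, hu.2]
    rw [hlen, abs_of_pos (by positivity), Real.norm_eq_abs] at hint
    calc _ ≤ (n : ℝ) * (1 / n * (1 / n)) := by gcongr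
      _ = 1 / n := by field_simp
  refine (Finset.abs_sum_le_sum_abs _ _).trans ((Finset.sum_le_card_nsmul _ _ _ hterm).trans_eq ?_)
  simp [hn'.ne']

lemma sum_card_subsetsWithSum_one (n : ℕ) (m : ℤ) :
    ((∑ j ∈ Finset.Icc 1 n, (subsetsWithSum n 1 (m - j)).card : ℕ) : ℤ) =
      max 0 (min (n : ℤ) (m - 1) + 1 - max 1 (m - n)) := by
  have : ∑ j ∈ Finset.Icc 1 n, (subsetsWithSum n 1 (m - j)).card =
      (Finset.Icc (max 1 (m - n)) (min (n : ℤ) (m - 1))).card := by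
    rw [Finset.sum_congr rfl fun (j : ℕ) _ => card_subsetsWithSum_one n (m - j), ← Finset.card_filter]
    refine Finset.card_nbij' (fun j : ℕ => (j : ℤ)) Int.toNat ?_ ?_ ?_ ?_
    · intro j hj; simp at hj ⊢; omega
    · intro j hj; simp at hj ⊢; omega
    · intro j _; simp
    · intro j hj; simp at hj ⊢; omega
  rw [this, Int.card_Icc, Int.ofNat_toNat, max_comm]

lemma exists_abs_factorial_mul_card_sub_le (k : ℕ) : ∃ C : ℝ, 0 ≤ C ∧ ∀ n : ℕ, 0 < n → ∀ m : ℤ,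
    |((k + 2)! : ℝ) * (subsetsWithSum n (k + 2) m).card -
      (n : ℝ) ^ (k + 1) * convSelf χ (k + 1) (m / n)| ≤ C * (n : ℝ) ^ k := by
  induction k with
  | zero =>
    refine ⟨2, by norm_num, fun n hn m => ?_⟩
    have hn' : (0 : ℝ) < n := by exact_mod_cast hn
    have h1 := abs_succ_mul_card_sub_sum_le n 0 m
    have h2 : (n : ℝ) ^ (0 + 1) * convSelf χ (0 + 1) (m / n) =
        ((max 0 (n - |m - n|) : ℤ) : ℝ) := by
      rw [zero_add, convSelf_indicator_one, pow_one, mul_max_of_nonneg _ _ hn'.le]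
      push_cast
      congr 1
      · simp
      · have : ((m : ℝ) - n) = n * (m / n - 1) := by field_simp
        rw [this, abs_mul, Nat.abs_cast]; ring
    have h3 : |∑ j ∈ Finset.Icc 1 n, ((subsetsWithSum n (0 + 1) (m - j)).card : ℝ) -
        ((max 0 (n - |m - n|) : ℤ) : ℝ)| ≤ 1 := by
      have : |((∑ j ∈ Finset.Icc 1 n, (subsetsWithSum n 1 (m - j)).card : ℕ) : ℤ) -
          max 0 (n - |m - n|)| ≤ 1 := by
        rw [sum_card_subsetsWithSum_one]
        rcases abs_cases (m - n : ℤ) with h | h <;> rw [abs_le] <;> omega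
      exact_mod_cast this
    rw [h2]
    refine (abs_sub_le _ _ _).trans ((add_le_add (le_of_eq_of_le ?_ h1) h3).trans_eq ?_)
    · norm_num [Nat.factorial]
    · norm_num
  | succ k ih =>
    obtain ⟨C, hC, ih⟩ := ih
    refine ⟨(k + 2)! + C + 1, by positivity, fun n hn m => ?_⟩
    have hn' : (0 : ℝ) < n := by exact_mod_cast hn
    have h1 := abs_succ_mul_card_sub_sum_le n (k + 1) m
    have h2 : |∑ j ∈ Finset.Icc 1 n, (((k + 2)! : ℝ) * (subsetsWithSum n (k + 2) (m - j)).card -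
        (n : ℝ) ^ (k + 1) * convSelf χ (k + 1) (m / n - j / n))| ≤ n * (C * n ^ k) := by
      refine (Finset.abs_sum_le_sum_abs _ _).trans
        ((Finset.sum_le_card_nsmul _ _ (C * n ^ k) fun j _ => ?_).trans_eq (by simp))
      have := ih n hn (m - j)
      push_cast at this
      rwa [sub_div] at this
    have h3 := abs_sum_sub_integral_le (abs_convSelf_indicator_sub_le k) hn ((m : ℝ) / n)
    rw [← conv_indicator_Icc] at h3
    rw [Finset.sum_sub_distrib, ← Finset.mul_sum, ← Finset.mul_sum] at h2
    change |_ - _ * convSelf χ (k + 1 + 1) _| ≤ _ at h3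
    set A : ℝ := ((subsetsWithSum n (k + 1 + 2) m).card : ℝ)
    set S : ℝ := ∑ j ∈ Finset.Icc 1 n, ((subsetsWithSum n (k + 2) (m - j)).card : ℝ)
    set J := convSelf χ (k + 1 + 1) (m / n)
    set R := ∑ j ∈ Finset.Icc 1 n, convSelf χ (k + 1) (m / n - j / n)
    have hfac : ((k + 1 + 2)! : ℝ) = (k + 1 + 2) * (k + 2)! := by
      rw [show k + 1 + 2 = (k + 2) + 1 by ring, Nat.factorial_succ]; push_cast; ring
    push_cast at h1
    calc |((k + 1 + 2)! : ℝ) * A - (n : ℝ) ^ (k + 1 + 1) * J|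
        = |(k + 2)! * (((k : ℝ) + 1 + 2) * A - S) + ((k + 2)! * S - (n : ℝ) ^ (k + 1) * R) +
            (n : ℝ) ^ (k + 1) * (R - n * J)| := by rw [hfac]; congr 1; ring
      _ ≤ (k + 2)! * |((k : ℝ) + 1 + 2) * A - S| + |(k + 2)! * S - (n : ℝ) ^ (k + 1) * R| +
            (n : ℝ) ^ (k + 1) * |R - n * J| := by
          refine (abs_add_three _ _ _).trans_eq ?_
          rw [abs_mul, abs_mul, Nat.abs_cast, abs_of_pos (pow_pos hn' _)]
      _ ≤ (k + 2)! * (n : ℝ) ^ (k + 1) + n * (C * n ^ k) + (n : ℝ) ^ (k + 1) * 1 := by gcongr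
      _ = ((k + 2)! + C + 1) * (n : ℝ) ^ (k + 1) := by ring

lemma sum_card_subsetsWithSum_le {n : ℕ} (hn : 0 < n) (k : ℕ) (m : ℤ) :
    ∑ i ∈ Finset.range (k + 2), (subsetsWithSum n i m).card ≤ (k + 2) * n ^ k := by
  refine (Finset.sum_le_card_nsmul _ _ (n ^ k) fun i hi => ?_).trans_eq (by simp)
  rcases i with _ | i
  · exact (card_subsetsWithSum_zero_le n m).trans (Nat.one_le_pow _ _ hn)
  · have := Finset.mem_range.1 hi
    exact (card_subsetsWithSum_succ_le n i m).trans (Nat.pow_le_pow_right hn (by omega))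

/-- For every `b ≥ 5` there are `C_b > 0` and `N` such that for all `n ≥ N` and all
integers `ℓ` with `(1728/1729)·n ≤ ℓ ≤ (b − 1728/1729)·n`,
`| c_{n,b}(ℓ) − (n^{b−1}/b!) · I(ℓ/n − b(b+1)/(2n)) | ≤ C_b · n^{b−2}`, where
`I = χ_{[0,1]}^{∗b}` is the Irwin–Hall density. -/
theorem bulk_asymptotic (b : ℕ) (hb : 5 ≤ b) :
    ∃ C : ℝ, 0 < C ∧ ∃ N : ℕ, ∀ n : ℕ, N ≤ n → ∀ ℓ : ℕ,
      (1728 / 1729 : ℝ) * n ≤ (ℓ : ℝ) → (ℓ : ℝ) ≤ ((b : ℝ) - 1728 / 1729) * n →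
      |(truncStaircaseCount n b ℓ : ℝ) -
          (n : ℝ) ^ (b - 1) / (Nat.factorial b : ℝ) *
            convSelf (Set.indicator (Set.Icc 0 1) (fun _ => (1 : ℝ))) (b - 1)
              ((ℓ : ℝ) / n - (b : ℝ) * ((b : ℝ) + 1) / (2 * n))| ≤
        C * (n : ℝ) ^ (b - 2) := by
  obtain ⟨k, rfl⟩ : ∃ k, b = k + 2 := ⟨b - 2, by omega⟩
  obtain ⟨C, hC, hcard⟩ := exists_abs_factorial_mul_card_sub_le k
  set B : ℝ := ((k + 2 : ℕ) : ℝ) with hB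
  have hB0 : 0 < B := by positivity
  refine ⟨B + C + B * (B + 1) / 2, by positivity, 1, fun n hn ℓ _ _ => ?_⟩
  have hn' : (0 : ℝ) < n := by exact_mod_cast hn
  have hlow : ((∑ i ∈ Finset.range (k + 2), (subsetsWithSum n i ℓ).card : ℕ) : ℝ) ≤
      B * (n : ℝ) ^ k := by
    rw [hB]; exact_mod_cast sum_card_subsetsWithSum_le hn k ℓ
  have hmain := hcard n hn ℓ
  have hshift := abs_convSelf_indicator_sub_le k ((ℓ : ℝ) / n)
    ((ℓ : ℝ) / n - B * (B + 1) / (2 * n))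
  rw [sub_sub_cancel, abs_of_nonneg (a := B * (B + 1) / (2 * n)) (by positivity)] at hshift
  rw [truncStaircaseCount_eq_sum, Finset.sum_range_succ, Nat.cast_add,
    show k + 2 - 1 = k + 1 by omega, show k + 2 - 2 = k by omega]
  rw [Int.cast_natCast] at hmain
  set L := ((∑ i ∈ Finset.range (k + 2), (subsetsWithSum n i ℓ).card : ℕ) : ℝ)
  set A : ℝ := ((subsetsWithSum n (k + 2) ℓ).card : ℝ)
  set I₀ := convSelf χ (k + 1) ((ℓ : ℝ) / n)
  set I₁ := convSelf χ (k + 1) ((ℓ : ℝ) / n - B * (B + 1) / (2 * n))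
  have hL : 0 ≤ L := Nat.cast_nonneg _
  set F : ℝ := ((k + 2)! : ℝ)
  have hF : 1 ≤ F := by exact Nat.one_le_cast.2 (Nat.factorial_pos _)
  have hF0 : 0 < F := by linarith
  calc |L + A - (n : ℝ) ^ (k + 1) / F * I₁|
      = |L + (F * A - (n : ℝ) ^ (k + 1) * I₀) / F + (n : ℝ) ^ (k + 1) * (I₀ - I₁) / F| := by
        congr 1; field_simp; ring
    _ ≤ L + |F * A - (n : ℝ) ^ (k + 1) * I₀| / F + (n : ℝ) ^ (k + 1) * |I₀ - I₁| / F := by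
        refine (abs_add_three _ _ _).trans_eq ?_
        rw [abs_div, abs_div, abs_mul, abs_of_pos hF0, abs_of_nonneg hL,
          abs_of_pos (pow_pos hn' _)]
    _ ≤ L + |F * A - (n : ℝ) ^ (k + 1) * I₀| + (n : ℝ) ^ (k + 1) * |I₀ - I₁| := by
        gcongr <;> exact div_le_self (by positivity) hF
    _ ≤ B * (n : ℝ) ^ k + C * (n : ℝ) ^ k + (n : ℝ) ^ (k + 1) * (B * (B + 1) / (2 * n)) := by
        gcongr
    _ = (B + C + B * (B + 1) / 2) * (n : ℝ) ^ k := by field_simp; ring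
end
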